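/- arXiv:2411.12311 — 6 statements merged into one kernel-verified Lean document; each statement's English description precedes it below -/
import Mathlib

section
/- Let m ≥ 3 be an integer. Consider the metric Lie algebra on ℝ^{m+2} with orthonormal basis f_1, f_2, e_1, …, e_m whose nonzero Lie brackets are [f_1, e_j] = cos(2πj/m)·e_j and [f_2, e_j] = sin(2πj/m)·e_j for j = 1,…,m. Then this metric Lie algebra is weakly Einstein (indeed Ř(X,Y) = m·⟨X,Y⟩ for all X,Y), but it is not Einstein. -/
open Module
open scoped InnerProductSpace BigOperators

noncomputable section

variable {V : Type*} [NormedAddCommGroup V] [InnerProductSpace ℝ V]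

/-- `br` is a Lie bracket: bilinear (in the first slot; bilinearity in the second slot
follows from antisymmetry), antisymmetric and satisfying the Jacobi identity. -/
structure IsLieBracket (br : V → V → V) : Prop where
  add_left : ∀ X Y Z : V, br (X + Y) Z = br X Z + br Y Z
  smul_left : ∀ (c : ℝ) (X Y : V), br (c • X) Y = c • br X Y
  antisymm : ∀ X Y : V, br X Y = - br Y X
  jacobi : ∀ X Y Z : V, br (br X Y) Z + br (br Y Z) X + br (br Z X) Y = 0

/-- `nab` is the Levi-Civita product of the metric Lie algebra `(V, ⟪·,·⟫, br)`,
determined by the Koszul formula. -/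
def IsLeviCivita (br nab : V → V → V) : Prop :=
  ∀ U W Z : V, ⟪nab U W, Z⟫_ℝ =
    (1 / 2) * (⟪br U W, Z⟫_ℝ - ⟪br W Z, U⟫_ℝ + ⟪br Z U, W⟫_ℝ)

/-- The curvature operator `R(X,Y)Z = ∇_X ∇_Y Z − ∇_Y ∇_X Z − ∇_{[X,Y]} Z`. -/
def curvOp (br nab : V → V → V) (X Y Z : V) : V :=
  nab X (nab Y Z) - nab Y (nab X Z) - nab (br X Y) Z

/-- The curvature tensor `R(X,Y,Z,W) = ⟨R(X,Y)Z, W⟩`. -/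
def curv (br nab : V → V → V) (X Y Z W : V) : ℝ :=
  ⟪curvOp br nab X Y Z, W⟫_ℝ

/-- `Ř(X,Y) = Σ_{a,b,c} R(X,e_a,e_b,e_c) R(Y,e_a,e_b,e_c)` relative to an
orthonormal basis `e`. -/
def checkR (br nab : V → V → V) {ι : Type*} [Fintype ι]
    (e : OrthonormalBasis ι ℝ V) (X Y : V) : ℝ :=
  ∑ a, ∑ b, ∑ c,
    curv br nab X (e a) (e b) (e c) * curv br nab Y (e a) (e b) (e c)

/-- The metric Lie algebra is weakly Einstein:
`Ř(X,Y) = (‖R‖²/n) ⟨X,Y⟩` where `‖R‖² = Σ_i Ř(e_i,e_i)` and `n = dim V`. -/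
def WeaklyEinstein (br nab : V → V → V) {ι : Type*} [Fintype ι]
    (e : OrthonormalBasis ι ℝ V) : Prop :=
  ∀ X Y : V, checkR br nab e X Y =
    ((∑ i, checkR br nab e (e i) (e i)) / (Fintype.card ι : ℝ)) * ⟪X, Y⟫_ℝ

/-- The Ricci form `Ric(X,Y) = Σ_a R(e_a,X,Y,e_a)`. -/
def ricci (br nab : V → V → V) {ι : Type*} [Fintype ι]
    (e : OrthonormalBasis ι ℝ V) (X Y : V) : ℝ :=
  ∑ a, curv br nab (e a) X Y (e a)

/-- The metric Lie algebra is Einstein: the Ricci form is a scalar multiple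
of the inner product. -/
def IsEinstein (br nab : V → V → V) {ι : Type*} [Fintype ι]
    (e : OrthonormalBasis ι ℝ V) : Prop :=
  ∃ κ : ℝ, ∀ X Y : V, ricci br nab e X Y = κ * ⟪X, Y⟫_ℝ

/-- A (Lie) bracket is nilpotent: all sufficiently long iterated brackets vanish. -/
def IsNilpotentBracket (br : V → V → V) : Prop :=
  ∃ k : ℕ, ∀ (f : Fin k → V) (X : V), (List.ofFn f).foldr br X = 0

/-- The nontrivial powers of a primitive `m`-th root of unity sum to zero, in terms of the real and
imaginary parts of `exp (2 π i d / m)`. -/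
theorem sum_cos_sin_eq_zero {m d : ℕ} (hd : 0 < d) (hdm : d < m) :
    ∑ k : Fin m, Real.cos (d * (2 * Real.pi * ((k : ℝ) + 1) / m)) = 0 ∧
      ∑ k : Fin m, Real.sin (d * (2 * Real.pi * ((k : ℝ) + 1) / m)) = 0 := by
  have hm : m ≠ 0 := by omega
  have hζ := Complex.isPrimitiveRoot_exp m hm
  set ζ := Complex.exp (2 * Real.pi * Complex.I / m) with hζdef
  have hne : ζ ^ d ≠ 1 := hζ.pow_ne_one_of_pos_of_lt hd.ne' hdm
  have hpow : (ζ ^ d) ^ m = 1 := by rw [← pow_mul, mul_comm, pow_mul, hζ.pow_eq_one, one_pow]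
  have hgeom : ∑ k : Fin m, (ζ ^ d) ^ (k : ℕ) = 0 := by
    rw [Fin.sum_univ_eq_sum_range (fun k => (ζ ^ d) ^ k)]
    have h := mul_geom_sum (ζ ^ d) m
    rw [hpow, sub_self] at h
    exact (mul_eq_zero.mp h).resolve_left (sub_ne_zero.mpr hne)
  have hterm : ∀ k : Fin m, Complex.exp
      (((d * (2 * Real.pi * ((k : ℝ) + 1) / m) : ℝ) : ℂ) * Complex.I)
        = ζ ^ d * (ζ ^ d) ^ (k : ℕ) := by
    intro k
    rw [← pow_succ', ← pow_mul, hζdef, ← Complex.exp_nat_mul]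
    congr 1
    push_cast
    ring
  have hsum : ∑ k : Fin m, Complex.exp
      (((d * (2 * Real.pi * ((k : ℝ) + 1) / m) : ℝ) : ℂ) * Complex.I) = 0 := by
    simp_rw [hterm, ← Finset.mul_sum, hgeom, mul_zero]
  constructor
  · have h := congrArg Complex.re hsum
    simpa only [Complex.re_sum, Complex.exp_ofReal_mul_I_re, Complex.zero_re] using h
  · have h := congrArg Complex.im hsum
    simpa only [Complex.im_sum, Complex.exp_ofReal_mul_I_im, Complex.zero_im] using h

section DiagonalAction

variable {m : ℕ}

/-- The bracket on `ℝ^{m+2}` for which the first two basis vectors act on the remaining ones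
diagonally, with weights `c` and `s`. -/
structure IsDiagonalBracket (c s : Fin m → ℝ)
    (br : EuclideanSpace ℝ (Fin (m + 2)) → EuclideanSpace ℝ (Fin (m + 2)) →
      EuclideanSpace ℝ (Fin (m + 2))) : Prop where
  zero : ∀ x y, br x y 0 = 0
  one : ∀ x y, br x y 1 = 0
  succ : ∀ x y (k : Fin m), br x y k.succ.succ =
    c k * (x 0 * y k.succ.succ - x k.succ.succ * y 0) +
      s k * (x 1 * y k.succ.succ - x k.succ.succ * y 1)

variable {c s : Fin m → ℝ}
  {br nab : EuclideanSpace ℝ (Fin (m + 2)) → EuclideanSpace ℝ (Fin (m + 2)) →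
    EuclideanSpace ℝ (Fin (m + 2))}

theorem inner_eq_split (x y : EuclideanSpace ℝ (Fin (m + 2))) :
    ⟪x, y⟫_ℝ = x 0 * y 0 + x 1 * y 1 + ∑ k : Fin m, x k.succ.succ * y k.succ.succ := by
  simp only [PiLp.inner_apply, Fin.sum_univ_succ, RCLike.inner_apply, conj_trivial,
    Fin.succ_zero_eq_one, mul_comm (y _), add_assoc]

theorem succ_succ_ne_one (k : Fin m) : k.succ.succ ≠ 1 := by
  simp [Fin.ext_iff]

theorem inner_basisFun_right (x : EuclideanSpace ℝ (Fin (m + 2))) (a : Fin (m + 2)) :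
    ⟪x, EuclideanSpace.basisFun (Fin (m + 2)) ℝ a⟫_ℝ = x a := by
  simp [EuclideanSpace.inner_single_right]

theorem IsDiagonalBracket.leviCivita_zero (hbr : IsDiagonalBracket c s br)
    (hnab : IsLeviCivita br nab) (U W : EuclideanSpace ℝ (Fin (m + 2))) :
    nab U W 0 = ∑ k : Fin m, c k * (U k.succ.succ * W k.succ.succ) := by
  rw [← inner_basisFun_right, hnab, inner_eq_split, inner_eq_split, inner_eq_split]
  simp only [hbr.zero, hbr.one, hbr.succ, EuclideanSpace.basisFun_apply, PiLp.single_apply,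
    Fin.succ_ne_zero, one_ne_zero, if_true, if_false, ← Finset.sum_sub_distrib,
    ← Finset.sum_add_distrib, Finset.mul_sum, zero_mul, zero_add]
  exact Finset.sum_congr rfl fun k _ => by ring

theorem IsDiagonalBracket.leviCivita_one (hbr : IsDiagonalBracket c s br)
    (hnab : IsLeviCivita br nab) (U W : EuclideanSpace ℝ (Fin (m + 2))) :
    nab U W 1 = ∑ k : Fin m, s k * (U k.succ.succ * W k.succ.succ) := by
  rw [← inner_basisFun_right, hnab, inner_eq_split, inner_eq_split, inner_eq_split]
  simp only [hbr.zero, hbr.one, hbr.succ, EuclideanSpace.basisFun_apply, PiLp.single_apply,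
    succ_succ_ne_one, zero_ne_one, if_true, if_false, ← Finset.sum_sub_distrib,
    ← Finset.sum_add_distrib, Finset.mul_sum, zero_mul, zero_add]
  exact Finset.sum_congr rfl fun k _ => by ring

theorem IsDiagonalBracket.leviCivita_succ (hbr : IsDiagonalBracket c s br)
    (hnab : IsLeviCivita br nab) (U W : EuclideanSpace ℝ (Fin (m + 2))) (k : Fin m) :
    nab U W k.succ.succ = -(U k.succ.succ * (c k * W 0 + s k * W 1)) := by
  have hsum : ∀ f : Fin m → ℝ, (∀ j ≠ k, f j = 0) → ∑ j, f j = f k := fun f hf =>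
    Finset.sum_eq_single k (fun j _ hj => hf j hj) (by simp)
  rw [← inner_basisFun_right, hnab, inner_eq_split, inner_eq_split, inner_eq_split,
    hsum _ (by simp +contextual), hsum _ (by simp +contextual [hbr.succ, (succ_succ_ne_one _).symm]),
    hsum _ (by simp +contextual [hbr.succ, (succ_succ_ne_one _).symm])]
  simp [hbr.zero, hbr.one, hbr.succ, (succ_succ_ne_one _).symm]
  ring

theorem curv_basisFun_right (X Y Z : EuclideanSpace ℝ (Fin (m + 2))) (a : Fin (m + 2)) :
    curv br nab X Y Z (EuclideanSpace.basisFun (Fin (m + 2)) ℝ a) =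
      nab X (nab Y Z) a - nab Y (nab X Z) a - nab (br X Y) Z a := by
  rw [curv, inner_basisFun_right, curvOp, PiLp.sub_apply, PiLp.sub_apply]

theorem IsDiagonalBracket.curv_zero (hbr : IsDiagonalBracket c s br)
    (hnab : IsLeviCivita br nab) (X Y Z : EuclideanSpace ℝ (Fin (m + 2))) :
    curv br nab X Y Z (EuclideanSpace.basisFun (Fin (m + 2)) ℝ 0) =
      -∑ k : Fin m, c k * (br X Y k.succ.succ * Z k.succ.succ) := by
  simp only [curv_basisFun_right, hbr.leviCivita_zero hnab, hbr.leviCivita_succ hnab,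
    ← Finset.sum_sub_distrib, ← Finset.sum_neg_distrib]
  exact Finset.sum_congr rfl fun k _ => by ring

theorem IsDiagonalBracket.curv_one (hbr : IsDiagonalBracket c s br)
    (hnab : IsLeviCivita br nab) (X Y Z : EuclideanSpace ℝ (Fin (m + 2))) :
    curv br nab X Y Z (EuclideanSpace.basisFun (Fin (m + 2)) ℝ 1) =
      -∑ k : Fin m, s k * (br X Y k.succ.succ * Z k.succ.succ) := by
  simp only [curv_basisFun_right, hbr.leviCivita_one hnab, hbr.leviCivita_succ hnab,
    ← Finset.sum_sub_distrib, ← Finset.sum_neg_distrib]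
  exact Finset.sum_congr rfl fun k _ => by ring

theorem IsDiagonalBracket.curv_succ (hbr : IsDiagonalBracket c s br)
    (hnab : IsLeviCivita br nab) (X Y Z : EuclideanSpace ℝ (Fin (m + 2))) (l : Fin m) :
    curv br nab X Y Z (EuclideanSpace.basisFun (Fin (m + 2)) ℝ l.succ.succ) =
      br X Y l.succ.succ * (c l * Z 0 + s l * Z 1)
        + ∑ k : Fin m, (c l * c k + s l * s k) * Z k.succ.succ *
          (X k.succ.succ * Y l.succ.succ - X l.succ.succ * Y k.succ.succ) := by
  have hsum : ∀ U : EuclideanSpace ℝ (Fin (m + 2)),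
      c l * nab U Z 0 + s l * nab U Z 1 =
        ∑ k : Fin m, (c l * c k + s l * s k) * Z k.succ.succ * U k.succ.succ := by
    intro U
    rw [hbr.leviCivita_zero hnab, hbr.leviCivita_one hnab, Finset.mul_sum, Finset.mul_sum,
      ← Finset.sum_add_distrib]
    exact Finset.sum_congr rfl fun k _ => by ring
  simp only [curv_basisFun_right, hbr.leviCivita_succ hnab, hsum, mul_sub, Finset.sum_sub_distrib,
    Finset.mul_sum]
  rw [sub_neg_eq_add, add_comm, neg_sub_neg]
  congr 2 <;> exact Finset.sum_congr rfl fun k _ => by ring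

theorem sum_sum_delta_sub_delta (g : Fin m → Fin m → ℝ) (x y : Fin m → ℝ) (j : Fin m) :
    ∑ k, ∑ l, (g l k * (x k * (if l = j then 1 else 0) - x l * (if k = j then 1 else 0))) *
        (g l k * (y k * (if l = j then 1 else 0) - y l * (if k = j then 1 else 0))) =
      ∑ k, x k * y k * (g j k ^ 2 + g k j ^ 2) - 2 * (x j * y j * g j j ^ 2) := by
  have h : ∀ k l, (g l k * (x k * (if l = j then 1 else 0) - x l * (if k = j then 1 else 0))) *
        (g l k * (y k * (if l = j then 1 else 0) - y l * (if k = j then 1 else 0))) =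
      (if l = j then x k * y k * g l k ^ 2 else 0) + (if k = j then x l * y l * g l k ^ 2 else 0) -
        (if l = j then if k = j then 2 * (x j * y j * g j j ^ 2) else 0 else 0) := by
    intro k l
    by_cases hl : l = j <;> by_cases hk : k = j <;> simp [hl, hk] <;> ring
  simp only [h, Finset.sum_sub_distrib, Finset.sum_add_distrib, mul_add]
  rw [Finset.sum_comm (f := fun k l => if k = j then x l * y l * g l k ^ 2 else 0)]
  simp

theorem basisFun_apply_eq_ite (a k : Fin (m + 2)) : EuclideanSpace.basisFun (Fin (m + 2)) ℝ a k = if k = a then 1 else 0 := by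
  simp [PiLp.single_apply]

theorem IsDiagonalBracket.apply_basisFun_zero (hbr : IsDiagonalBracket c s br)
    (X : EuclideanSpace ℝ (Fin (m + 2))) (k : Fin m) :
    br X (EuclideanSpace.basisFun (Fin (m + 2)) ℝ 0) k.succ.succ = -(c k * X k.succ.succ) := by
  simp [hbr.succ]

theorem IsDiagonalBracket.apply_basisFun_one (hbr : IsDiagonalBracket c s br)
    (X : EuclideanSpace ℝ (Fin (m + 2))) (k : Fin m) :
    br X (EuclideanSpace.basisFun (Fin (m + 2)) ℝ 1) k.succ.succ = -(s k * X k.succ.succ) := by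
  simp [hbr.succ, succ_succ_ne_one]

theorem IsDiagonalBracket.apply_basisFun_succ (hbr : IsDiagonalBracket c s br)
    (X : EuclideanSpace ℝ (Fin (m + 2))) (j k : Fin m) :
    br X (EuclideanSpace.basisFun (Fin (m + 2)) ℝ j.succ.succ) k.succ.succ = if k = j then c j * X 0 + s j * X 1 else 0 := by
  by_cases h : k = j <;>
    simp [hbr.succ, PiLp.single_apply, (Fin.succ_ne_zero _).symm, (succ_succ_ne_one _).symm, h]

theorem IsDiagonalBracket.curv_succ_succ_succ (hbr : IsDiagonalBracket c s br)
    (hnab : IsLeviCivita br nab) (X : EuclideanSpace ℝ (Fin (m + 2))) (j k l : Fin m) :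
    curv br nab X (EuclideanSpace.basisFun (Fin (m + 2)) ℝ j.succ.succ) (EuclideanSpace.basisFun (Fin (m + 2)) ℝ k.succ.succ) (EuclideanSpace.basisFun (Fin (m + 2)) ℝ l.succ.succ) =
      (c l * c k + s l * s k) * (X k.succ.succ * (if l = j then 1 else 0) -
        X l.succ.succ * (if k = j then 1 else 0)) := by
  rw [hbr.curv_succ hnab]
  simp only [basisFun_apply_eq_ite, Fin.succ_inj, (Fin.succ_ne_zero _).symm,
    (succ_succ_ne_one _).symm, if_false, mul_zero, add_zero, zero_add, mul_ite, mul_one, ite_mul,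
    zero_mul, Finset.sum_ite_eq', Finset.mem_univ, if_true]

theorem IsDiagonalBracket.checkR_basisFun (hbr : IsDiagonalBracket c s br)
    (hnab : IsLeviCivita br nab) (hcs : ∀ k, c k ^ 2 + s k ^ 2 = 1)
    (X Y : EuclideanSpace ℝ (Fin (m + 2))) :
    checkR br nab (EuclideanSpace.basisFun (Fin (m + 2)) ℝ) X Y =
      2 * ∑ j : Fin m, (c j * X 0 + s j * X 1) * (c j * Y 0 + s j * Y 1) +
        2 * ∑ l : Fin m, X l.succ.succ * Y l.succ.succ *
          ∑ j : Fin m, (c l * c j + s l * s j) ^ 2 := by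
  have hgram : ∑ j, ∑ l, X l.succ.succ * Y l.succ.succ *
      ((c j * c l + s j * s l) ^ 2 + (c l * c j + s l * s j) ^ 2) =
      ∑ l, 2 * (X l.succ.succ * Y l.succ.succ * ∑ j, (c l * c j + s l * s j) ^ 2) := by
    rw [Finset.sum_comm]
    simp only [Finset.mul_sum]
    exact Finset.sum_congr rfl fun l _ => Finset.sum_congr rfl fun j _ => by ring
  simp only [checkR, Fin.sum_univ_succ (n := m + 1), Fin.sum_univ_succ (n := m),
    Fin.succ_zero_eq_one, hbr.curv_succ_succ_succ hnab, Finset.sum_add_distrib,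
    sum_sum_delta_sub_delta (fun l k => c l * c k + s l * s k)
      (fun k => X k.succ.succ) (fun k => Y k.succ.succ)]
  simp only [hbr.curv_zero hnab, hbr.curv_one hnab, hbr.curv_succ hnab, hbr.apply_basisFun_zero,
    hbr.apply_basisFun_one, hbr.apply_basisFun_succ]
  simp [-EuclideanSpace.basisFun_apply, basisFun_apply_eq_ite, succ_succ_ne_one,
    (Fin.succ_ne_zero _).symm, (succ_succ_ne_one _).symm, hgram]
  simp only [Finset.mul_sum _ _ (2 : ℝ), ← Finset.sum_add_distrib, ← Finset.sum_sub_distrib]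
  refine Finset.sum_congr rfl fun k _ => ?_
  linear_combination
    2 * (c k * X 0 + s k * X 1) * (c k * Y 0 + s k * Y 1) * hcs k

theorem IsDiagonalBracket.ricci_basisFun_zero (hbr : IsDiagonalBracket c s br)
    (hnab : IsLeviCivita br nab) :
    ricci br nab (EuclideanSpace.basisFun (Fin (m + 2)) ℝ) (EuclideanSpace.basisFun (Fin (m + 2)) ℝ 0) (EuclideanSpace.basisFun (Fin (m + 2)) ℝ 0) = -∑ k, c k ^ 2 := by
  simp only [ricci, Fin.sum_univ_succ (n := m + 1), Fin.sum_univ_succ (n := m),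
    Fin.succ_zero_eq_one, hbr.curv_zero hnab, hbr.curv_one hnab, hbr.curv_succ hnab,
    hbr.apply_basisFun_zero]
  simp [-EuclideanSpace.basisFun_apply, basisFun_apply_eq_ite, sq]

theorem IsDiagonalBracket.ricci_basisFun_succ (hbr : IsDiagonalBracket c s br)
    (hnab : IsLeviCivita br nab) (k : Fin m) :
    ricci br nab (EuclideanSpace.basisFun (Fin (m + 2)) ℝ) (EuclideanSpace.basisFun (Fin (m + 2)) ℝ k.succ.succ) (EuclideanSpace.basisFun (Fin (m + 2)) ℝ k.succ.succ) = -(c k * ∑ l, c l + s k * ∑ l, s l) := by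
  simp only [ricci, Fin.sum_univ_succ (n := m + 1), Fin.sum_univ_succ (n := m),
    Fin.succ_zero_eq_one, hbr.curv_succ_succ_succ hnab]
  simp only [hbr.curv_zero hnab, hbr.curv_one hnab, hbr.apply_basisFun_succ]
  simp [-EuclideanSpace.basisFun_apply, basisFun_apply_eq_ite, mul_sub, Finset.sum_add_distrib,
    mul_comm (c k), mul_comm (s k), Finset.sum_mul]
  ring

theorem IsDiagonalBracket.checkR_eq_of_tight (hbr : IsDiagonalBracket c s br)
    (hnab : IsLeviCivita br nab) (hcs : ∀ k, c k ^ 2 + s k ^ 2 = 1) {r : ℝ}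
    (hcc : ∑ k, c k ^ 2 = r / 2) (hss : ∑ k, s k ^ 2 = r / 2) (hcs₀ : ∑ k, c k * s k = 0)
    (X Y : EuclideanSpace ℝ (Fin (m + 2))) :
    checkR br nab (EuclideanSpace.basisFun (Fin (m + 2)) ℝ) X Y = r * ⟪X, Y⟫_ℝ := by
  have hquad : ∀ a b a' b' : ℝ, ∑ k, (c k * a + s k * b) * (c k * a' + s k * b') =
      r / 2 * (a * a' + b * b') := by
    intro a b a' b'
    calc ∑ k, (c k * a + s k * b) * (c k * a' + s k * b')
        = (a * a') * ∑ k, c k ^ 2 + (b * b') * ∑ k, s k ^ 2 +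
            (a * b' + b * a') * ∑ k, c k * s k := by
          simp only [Finset.mul_sum, ← Finset.sum_add_distrib]
          exact Finset.sum_congr rfl fun k _ => by ring
      _ = r / 2 * (a * a' + b * b') := by rw [hcc, hss, hcs₀]; ring
  have hgram : ∀ l, ∑ j, (c l * c j + s l * s j) ^ 2 = r / 2 := by
    intro l
    simp only [sq, mul_comm (c l), mul_comm (s l), hquad]
    linear_combination r / 2 * hcs l
  rw [hbr.checkR_basisFun hnab hcs, inner_eq_split]
  simp only [hgram, hquad, ← Finset.sum_mul]
  ring

end DiagonalAction

/-- **Example 1 of the paper.** For `m ≥ 3`, the solvable metric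
Lie algebra on `ℝ^{m+2}` with orthonormal basis `f_1, f_2, e_1, …, e_m`
(`f_1, f_2` at coordinates `0, 1` and `e_j` at coordinate `j+1`) and nonzero
brackets `[f_1,e_j] = cos(2πj/m)·e_j`, `[f_2,e_j] = sin(2πj/m)·e_j` is weakly
Einstein with `Ř(X,Y) = m·⟨X,Y⟩`, but is not Einstein. -/
theorem cossin_example_weaklyEinstein_not_einstein
    (m : ℕ) (hm : 3 ≤ m)
    (br nab : EuclideanSpace ℝ (Fin (m + 2)) → EuclideanSpace ℝ (Fin (m + 2)) →
      EuclideanSpace ℝ (Fin (m + 2)))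
    (hbr : ∀ (x y : EuclideanSpace ℝ (Fin (m + 2))) (k : Fin (m + 2)),
      br x y k =
        if 2 ≤ (k : ℕ) then
          Real.cos (2 * Real.pi * (((k : ℕ) : ℝ) - 1) / m)
              * (x ⟨0, by omega⟩ * y k - x k * y ⟨0, by omega⟩)
            + Real.sin (2 * Real.pi * (((k : ℕ) : ℝ) - 1) / m)
              * (x ⟨1, by omega⟩ * y k - x k * y ⟨1, by omega⟩)
        else 0)
    (hnab : IsLeviCivita br nab) :
    (∀ X Y : EuclideanSpace ℝ (Fin (m + 2)),
        checkR br nab (EuclideanSpace.basisFun (Fin (m + 2)) ℝ) X Y = m * ⟪X, Y⟫_ℝ) ∧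
      WeaklyEinstein br nab (EuclideanSpace.basisFun (Fin (m + 2)) ℝ) ∧
      ¬ IsEinstein br nab (EuclideanSpace.basisFun (Fin (m + 2)) ℝ) := by
  set θ : Fin m → ℝ := fun k => 2 * Real.pi * ((k : ℝ) + 1) / m with hθ
  have hdiag : IsDiagonalBracket (fun k => Real.cos (θ k)) (fun k => Real.sin (θ k)) br := by
    refine ⟨fun x y => by simp [hbr], fun x y => by simp [hbr], fun x y k => ?_⟩
    have hk : (((k.succ.succ : Fin (m + 2)) : ℕ) : ℝ) - 1 = (k : ℝ) + 1 := by
      push_cast [Fin.val_succ]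
      ring
    rw [hbr, if_pos (by simp), hk]
    rfl
  obtain ⟨hcos, hsin⟩ := sum_cos_sin_eq_zero (m := m) (d := 1) (by omega) (by omega)
  obtain ⟨hcos₂, hsin₂⟩ := sum_cos_sin_eq_zero (m := m) (d := 2) (by omega) (by omega)
  simp only [Nat.cast_one, one_mul] at hcos hsin
  simp only [Nat.cast_ofNat] at hcos₂ hsin₂
  have hcc : ∑ k, Real.cos (θ k) ^ 2 = (m : ℝ) / 2 := by
    simp only [Real.cos_sq, Finset.sum_add_distrib, ← Finset.sum_div, hθ, hcos₂]
    simp [div_eq_mul_inv]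
  have hss : ∑ k, Real.sin (θ k) ^ 2 = (m : ℝ) / 2 := by
    simp only [Real.sin_sq, Finset.sum_sub_distrib, hcc]
    simp
    ring
  have hsc : ∑ k, Real.cos (θ k) * Real.sin (θ k) = 0 := by
    have h : ∀ k, Real.cos (θ k) * Real.sin (θ k) = Real.sin (2 * θ k) / 2 := fun k => by
      rw [Real.sin_two_mul]
      ring
    rw [Finset.sum_congr rfl fun k _ => h k, ← Finset.sum_div]
    simp only [hθ, hsin₂, zero_div]
  have hcheck := hdiag.checkR_eq_of_tight hnab (fun k => Real.cos_sq_add_sin_sq (θ k)) hcc hss hsc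
  refine ⟨hcheck, fun X Y => ?_, ?_⟩
  · have hcard : (m : ℝ) + 2 ≠ 0 := by positivity
    simp only [hcheck, OrthonormalBasis.inner_eq_one, mul_one, Finset.sum_const, Finset.card_univ,
      Fintype.card_fin, nsmul_eq_mul]
    push_cast
    field_simp
  · rintro ⟨κ, hκ⟩
    have h₁ := hκ (EuclideanSpace.basisFun (Fin (m + 2)) ℝ 0)
      (EuclideanSpace.basisFun (Fin (m + 2)) ℝ 0)
    have h₂ := hκ (EuclideanSpace.basisFun (Fin (m + 2)) ℝ (⟨0, by omega⟩ : Fin m).succ.succ)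
      (EuclideanSpace.basisFun (Fin (m + 2)) ℝ (⟨0, by omega⟩ : Fin m).succ.succ)
    rw [hdiag.ricci_basisFun_zero hnab, hcc, OrthonormalBasis.inner_eq_one] at h₁
    rw [hdiag.ricci_basisFun_succ hnab, hcos, hsin, OrthonormalBasis.inner_eq_one] at h₂
    have hm' : (3 : ℝ) ≤ m := by exact_mod_cast hm
    linarith
end
end

section
/- Let Q be a normal endomorphism (Q∘Qᵗ = Qᵗ∘Q) of a finite-dimensional real inner product space V such that S = (1/2)(Q+Qᵗ) satisfies S² = a²·id_V for some a ≥ 0. Then there exists an orthonormal basis of V with respect to which the matrix of Q is block diagonal, each diagonal block being either a 1×1 block equal to a or −a, or a 2×2 block of the form ±[[a, b],[−b, a]] with b ≠ 0. -/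
open Module
open scoped InnerProductSpace

noncomputable section

/-- An orthonormal family, paired up by an involution `σ`, on which the symmetric part `S` acts by
scalars `±a` constant on each pair and the skew part `A` acts by rotations within each pair. -/
structure IsBlockFamily {V ι : Type*} [NormedAddCommGroup V] [InnerProductSpace ℝ V]
    (S A : V →ₗ[ℝ] V) (a : ℝ) (e : ι → V) (σ : Equiv.Perm ι) : Prop where
  orthonormal : Orthonormal ℝ e
  involutive : ∀ i, σ (σ i) = i
  blocks : ∀ i, ∃ ε b : ℝ, (ε = 1 ∨ ε = -1) ∧ (b = 0 ↔ σ i = i) ∧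
    S (e i) = (ε * a) • e i ∧ S (e (σ i)) = (ε * a) • e (σ i) ∧
    A (e i) = -((ε * b) • e (σ i)) ∧ A (e (σ i)) = (ε * b) • e i

section

variable {V : Type*} [NormedAddCommGroup V] [InnerProductSpace ℝ V]
  {S A : V →ₗ[ℝ] V} {a : ℝ}

theorem IsBlockFamily.sumElim {ι κ : Type*} {e : ι → V} {f : κ → V}
    {σ : Equiv.Perm ι} {τ : Equiv.Perm κ}
    (he : IsBlockFamily S A a e σ) (hf : IsBlockFamily S A a f τ)
    (hef : ∀ i j, inner ℝ (e i) (f j) = 0) :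
    IsBlockFamily S A a (Sum.elim e f) (Equiv.sumCongr σ τ) where
  orthonormal := by
    refine ⟨?_, ?_⟩
    · rintro (i | j)
      · exact he.orthonormal.1 i
      · exact hf.orthonormal.1 j
    · rintro (i | i) (j | j) hij
      · exact he.orthonormal.2 fun h => hij (h ▸ rfl)
      · exact hef i j
      · exact (real_inner_comm _ _).trans (hef j i)
      · exact hf.orthonormal.2 fun h => hij (h ▸ rfl)
  involutive := by
    rintro (i | j)
    · simp [he.involutive i]
    · simp [hf.involutive j]
  blocks := by
    rintro (i | j)
    · simpa using he.blocks i
    · simpa using hf.blocks j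

theorem exists_unit_common_eigenvector [FiniteDimensional ℝ V]
    (hcomm : ∀ x, S (A x) = A (S x)) (hskew : ∀ x y, inner ℝ (A x) y = -inner ℝ x (A y))
    (hS2 : ∀ x, S (S x) = a ^ 2 • x) (W : Submodule ℝ V) (hW : W ≠ ⊥)
    (hSW : ∀ x ∈ W, S x ∈ W) (hAW : ∀ x ∈ W, A x ∈ W) :
    ∃ v ∈ W, ‖v‖ = 1 ∧ ∃ ε μ : ℝ, (ε = 1 ∨ ε = -1) ∧ S v = (ε * a) • v ∧ A (A v) = μ • v := by
  obtain ⟨ε, hε, x, hxW, hx, hSx⟩ : ∃ ε : ℝ, (ε = 1 ∨ ε = -1) ∧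
      ∃ x ∈ W, x ≠ 0 ∧ S x = (ε * a) • x := by
    obtain ⟨x, hxW, hx⟩ := W.ne_bot_iff.1 hW
    by_cases h : S x + a • x = 0
    · exact ⟨-1, Or.inr rfl, x, hxW, hx, by rw [eq_neg_of_add_eq_zero_left h]; module⟩
    · refine ⟨1, Or.inl rfl, S x + a • x, W.add_mem (hSW x hxW) (W.smul_mem a hxW), h, ?_⟩
      rw [map_add, map_smul, hS2]
      module
  let E : Submodule ℝ V := W ⊓ Module.End.eigenspace S (ε * a)
  have hE : ∀ y ∈ E, (A ∘ₗ A) y ∈ E := by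
    rintro y ⟨hyW, hy⟩
    refine ⟨hAW _ (hAW _ hyW), ?_⟩
    rw [SetLike.mem_coe, Module.End.mem_eigenspace_iff] at hy ⊢
    rw [LinearMap.comp_apply, hcomm, hcomm, hy, map_smul, map_smul]
  have : Nontrivial E :=
    ⟨⟨⟨x, hxW, Module.End.mem_eigenspace_iff.2 hSx⟩, 0, fun h => hx (congrArg Subtype.val h)⟩⟩
  have hsymm : (A ∘ₗ A).IsSymmetric := fun y z => by
    rw [LinearMap.comp_apply, LinearMap.comp_apply, hskew, hskew, neg_neg]
  obtain ⟨μ, y, hy⟩ : ∃ μ : ℝ, ∃ y, Module.End.HasEigenvector ((A ∘ₗ A).restrict hE) μ y :=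
    ⟨_, (hsymm.restrict_invariant hE).hasEigenvalue_iSup_of_finiteDimensional.exists_hasEigenvector⟩
  have hAy := congrArg Subtype.val hy.apply_eq_smul
  have hy0 : (y : V) ≠ 0 := fun h => hy.2 (Subtype.ext h)
  have hSy : S y = (ε * a) • (y : V) := Module.End.mem_eigenspace_iff.1 y.2.2
  refine ⟨‖(y : V)‖⁻¹ • (y : V), W.smul_mem _ y.2.1, ?_, ε, μ, hε, ?_, ?_⟩
  · exact norm_smul_inv_norm (𝕜 := ℝ) hy0
  · rw [map_smul, hSy, smul_comm]
  · rw [map_smul, map_smul, smul_comm]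
    exact congrArg _ hAy

theorem exists_isBlockFamily_of_invariant [FiniteDimensional ℝ V]
    (hcomm : ∀ x, S (A x) = A (S x)) (hskew : ∀ x y, inner ℝ (A x) y = -inner ℝ x (A y))
    (hS2 : ∀ x, S (S x) = a ^ 2 • x) (W : Submodule ℝ V) (hW : W ≠ ⊥)
    (hSW : ∀ x ∈ W, S x ∈ W) (hAW : ∀ x ∈ W, A x ∈ W) :
    ∃ (κ : Type) (_ : Fintype κ) (_ : Nonempty κ) (f : κ → V) (τ : Equiv.Perm κ),
      IsBlockFamily S A a f τ ∧ ∀ j, f j ∈ W := by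
  obtain ⟨v, hvW, hv, ε, μ, hε, hSv, hAAv⟩ :=
    exists_unit_common_eigenvector hcomm hskew hS2 W hW hSW hAW
  by_cases hAv : A v = 0
  · refine ⟨Unit, inferInstance, inferInstance, fun _ => v, 1, ⟨?_, fun _ => rfl, ?_⟩,
      fun _ => hvW⟩
    · exact ⟨fun _ => hv, fun i j hij => (hij rfl).elim⟩
    · exact fun _ => ⟨ε, 0, hε, by simp, hSv, hSv, by simp [hAv], by simp [hAv]⟩
  have hb : ‖A v‖ ≠ 0 := norm_ne_zero_iff.2 hAv
  have hε2 : ε * ε = 1 := by rcases hε with rfl | rfl <;> norm_num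
  have hε0 : ε ≠ 0 := by rintro rfl; norm_num at hε2
  have hμ : μ = -‖A v‖ ^ 2 := by
    have h := hskew (A v) v
    rw [hAAv, real_inner_smul_left, real_inner_self_eq_norm_sq, real_inner_self_eq_norm_sq, hv] at h
    linarith
  have hvAv : inner ℝ v (A v) = 0 := by
    have h := hskew v v
    rw [real_inner_comm] at h
    linarith
  set b := ‖A v‖ with hb_def
  set w := b⁻¹ • A v with hw
  have hAv_eq : A v = b • w := by rw [hw, smul_inv_smul₀ hb]
  have hAw : A w = -(b • v) := by
    rw [hw, map_smul, hAAv, hμ, smul_smul, ← neg_smul]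
    congr 1
    field_simp
  have hSw : S w = (ε * a) • w := by
    rw [hw, map_smul, hcomm, hSv, map_smul, smul_comm]
  have hvw : inner ℝ v w = 0 := by rw [hw, real_inner_smul_right, hvAv, mul_zero]
  have hw1 : ‖w‖ = 1 := norm_smul_inv_norm (𝕜 := ℝ) hAv
  have hwW : w ∈ W := W.smul_mem _ (hAW v hvW)
  refine ⟨Bool, inferInstance, inferInstance, fun j => cond j w v, Equiv.boolNot,
    ⟨⟨?_, ?_⟩, by simp, ?_⟩, ?_⟩
  · rintro (_ | _)
    exacts [hv, hw1]
  · rintro (_ | _) (_ | _) hij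
    exacts [(hij rfl).elim, hvw, (real_inner_comm _ _).trans hvw, (hij rfl).elim]
  · rintro (_ | _)
    · refine ⟨ε, -(ε * b), hε, by simp [hε0, hb], hSv, hSw, ?_, ?_⟩
      · simp [← mul_assoc, hε2, hAv_eq]
      · simp [← mul_assoc, hε2, hAw]
    · refine ⟨ε, ε * b, hε, by simp [hε0, hb], hSw, hSv, ?_, ?_⟩
      · simp [← mul_assoc, hε2, hAw]
      · simp [← mul_assoc, hε2, hAv_eq]
  · rintro (_ | _)
    exacts [hvW, hwW]

theorem IsBlockFamily.exists_span_eq_top [FiniteDimensional ℝ V]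
    (hsymm : ∀ x y, inner ℝ (S x) y = inner ℝ x (S y))
    (hcomm : ∀ x, S (A x) = A (S x)) (hskew : ∀ x y, inner ℝ (A x) y = -inner ℝ x (A y))
    (hS2 : ∀ x, S (S x) = a ^ 2 • x) {ι : Type} [Fintype ι] {e : ι → V} {σ : Equiv.Perm ι}
    (he : IsBlockFamily S A a e σ) :
    ∃ (κ : Type) (_ : Fintype κ) (f : κ → V) (τ : Equiv.Perm κ),
      IsBlockFamily S A a f τ ∧ Submodule.span ℝ (Set.range f) = ⊤ := by
  induction hm : finrank ℝ V - Fintype.card ι using Nat.strong_induction_on generalizing ι with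
  | _ m ih =>
    by_cases htop : Submodule.span ℝ (Set.range e) = ⊤
    · exact ⟨ι, inferInstance, e, σ, he, htop⟩
    have hmem : ∀ x, x ∈ (Submodule.span ℝ (Set.range e))ᗮ ↔ ∀ i, inner ℝ (e i) x = 0 := by
      intro x
      rw [Submodule.mem_orthogonal]
      refine ⟨fun h i => h _ (Submodule.subset_span ⟨i, rfl⟩), fun h u hu => ?_⟩
      induction hu using Submodule.span_induction with
      | mem _ hu => obtain ⟨i, rfl⟩ := hu; exact h i
      | zero => exact inner_zero_left _
      | add _ _ _ _ h₁ h₂ => rw [inner_add_left, h₁, h₂, add_zero]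
      | smul _ _ _ h₁ => rw [real_inner_smul_left, h₁, mul_zero]
    obtain ⟨κ, _, _, f, τ, hf, hfW⟩ := exists_isBlockFamily_of_invariant hcomm hskew hS2
      (Submodule.span ℝ (Set.range e))ᗮ (fun h => htop (Submodule.orthogonal_eq_bot_iff.1 h))
      (by
        intro x hx
        rw [hmem] at hx ⊢
        intro i
        obtain ⟨ε, b, -, -, h, -⟩ := he.blocks i
        rw [← hsymm, h, real_inner_smul_left, hx, mul_zero])
      (by
        intro x hx
        rw [hmem] at hx ⊢
        intro i
        obtain ⟨ε, b, -, -, -, -, h, -⟩ := he.blocks i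
        rw [← neg_eq_zero, ← hskew, h, inner_neg_left, real_inner_smul_left, hx, mul_zero,
          neg_zero])
    have hsum := he.sumElim hf fun i j => (hmem _).1 (hfW j) i
    have hcard := hsum.orthonormal.linearIndependent.fintype_card_le_finrank
    have hκ := Fintype.card_pos (α := κ)
    rw [Fintype.card_sum] at hcard
    exact ih _ (by rw [← hm, Fintype.card_sum]; omega) hsum rfl

end

/-- A normal endomorphism `Q` of a finite-dimensional real
inner product space whose symmetric part `S = (1/2)(Q + Qᵗ)` satisfies
`S² = a²·id` (with `a ≥ 0`) has, in a suitable orthonormal basis, a block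
diagonal matrix whose blocks are `1×1` blocks `(±a)` or `2×2` blocks
`±[[a, b],[−b, a]]` with `b ≠ 0`. The pairing of the indices of the `2×2`
blocks is recorded by an involutive permutation `σ`. -/
theorem normal_operator_block_diagonal
    {V : Type*} [NormedAddCommGroup V] [InnerProductSpace ℝ V] [FiniteDimensional ℝ V]
    (Q : V →ₗ[ℝ] V)
    (hnormal : Q ∘ₗ LinearMap.adjoint Q = LinearMap.adjoint Q ∘ₗ Q)
    (a : ℝ) (ha : 0 ≤ a)
    (S : V →ₗ[ℝ] V) (hS : S = (1 / 2 : ℝ) • (Q + LinearMap.adjoint Q))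
    (hS2 : S ∘ₗ S = (a ^ 2) • LinearMap.id) :
    ∃ (n : ℕ) (e : OrthonormalBasis (Fin n) ℝ V) (σ : Equiv.Perm (Fin n)),
      (∀ i, σ (σ i) = i) ∧
      ∀ i : Fin n,
        (σ i = i ∧ (Q (e i) = a • e i ∨ Q (e i) = (-a) • e i)) ∨
        (σ i ≠ i ∧ ∃ ε b : ℝ, (ε = 1 ∨ ε = -1) ∧ b ≠ 0 ∧
          Q (e i) = (ε * a) • e i - (ε * b) • e (σ i) ∧
          Q (e (σ i)) = (ε * b) • e i + (ε * a) • e (σ i)) := by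
  let A : V →ₗ[ℝ] V := (1 / 2 : ℝ) • (Q - LinearMap.adjoint Q)
  have hQ : ∀ x, Q x = S x + A x := fun x => by
    simp only [hS, A, LinearMap.smul_apply, LinearMap.add_apply, LinearMap.sub_apply]
    module
  have hn : ∀ x, Q (LinearMap.adjoint Q x) = LinearMap.adjoint Q (Q x) := fun x =>
    LinearMap.congr_fun hnormal x
  have hsymm : ∀ x y, inner ℝ (S x) y = inner ℝ x (S y) := fun x y => by
    simp only [hS, LinearMap.smul_apply, LinearMap.add_apply, real_inner_smul_left,
      real_inner_smul_right, inner_add_left, inner_add_right, LinearMap.adjoint_inner_left,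
      LinearMap.adjoint_inner_right]
    ring
  have hskew : ∀ x y, inner ℝ (A x) y = -inner ℝ x (A y) := fun x y => by
    simp only [A, LinearMap.smul_apply, LinearMap.sub_apply, real_inner_smul_left,
      real_inner_smul_right, inner_sub_left, inner_sub_right, LinearMap.adjoint_inner_left,
      LinearMap.adjoint_inner_right]
    ring
  have hcomm : ∀ x, S (A x) = A (S x) := fun x => by
    simp only [hS, A, LinearMap.smul_apply, LinearMap.sub_apply, LinearMap.add_apply, map_smul,
      map_add, map_sub, hn]
    module
  obtain ⟨κ, _, f, τ, hf, htop⟩ := IsBlockFamily.exists_span_eq_top hsymm hcomm hskew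
    (fun x => LinearMap.congr_fun hS2 x) (ι := Empty) (e := Empty.elim) (σ := 1)
    ⟨⟨fun i => i.elim, fun i => i.elim⟩, fun i => i.elim, fun i => i.elim⟩
  let g := Fintype.equivFin κ
  refine ⟨Fintype.card κ, (OrthonormalBasis.mk hf.orthonormal htop.ge).reindex g,
    (g.symm.trans τ).trans g, fun i => by simp [hf.involutive], fun i => ?_⟩
  obtain ⟨ε, b, hε, hb, hS₁, hS₂, hA₁, hA₂⟩ := hf.blocks (g.symm i)
  have hfix : g (τ (g.symm i)) = i ↔ τ (g.symm i) = g.symm i := by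
    rw [← Equiv.eq_symm_apply]
  simp only [OrthonormalBasis.reindex_apply, OrthonormalBasis.coe_mk, Equiv.trans_apply,
    Equiv.symm_apply_apply, ne_eq, hfix, hQ, hS₁, hS₂, hA₁, hA₂]
  by_cases h : τ (g.symm i) = g.symm i
  · refine Or.inl ⟨h, ?_⟩
    rw [hb.2 h]
    rcases hε with rfl | rfl <;> simp
  · exact Or.inr ⟨h, ε, b, hε, fun h0 => h (hb.1 h0), (sub_eq_add_neg _ _).symm, add_comm _ _⟩
end
end

section
/- Let λ ≠ 0 and μ > 0 be real numbers with μ² = (√2/4)·λ². Consider the metric Lie algebra on ℝ⁵ with orthonormal basis e_1, e_2, e_3, f_1, f_2 whose nonzero Lie brackets are [e_1,e_2] = λe_3, [e_2,e_3] = λe_1, [e_3,e_1] = λe_2, and [f_1,f_2] = μf_2. Then this metric Lie algebra is weakly Einstein but not Einstein. -/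
open Module
open scoped InnerProductSpace BigOperators

noncomputable section

variable {V : Type*} [NormedAddCommGroup V] [InnerProductSpace ℝ V]

/-- The Levi-Civita product of `𝔰𝔲(2) × 𝔞𝔣𝔣(ℝ)` in coordinates. -/
theorem su2_hyperbolic_nab_apply (lam mu : ℝ)
    (br nab : EuclideanSpace ℝ (Fin 5) → EuclideanSpace ℝ (Fin 5) →
      EuclideanSpace ℝ (Fin 5))
    (hbr : ∀ x y : EuclideanSpace ℝ (Fin 5),
      br x y = ![lam * (x 1 * y 2 - x 2 * y 1),
                  lam * (x 2 * y 0 - x 0 * y 2),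
                  lam * (x 0 * y 1 - x 1 * y 0),
                  0,
                  mu * (x 3 * y 4 - x 4 * y 3)])
    (hnab : IsLeviCivita br nab) (x y : EuclideanSpace ℝ (Fin 5)) :
    (nab x y : Fin 5 → ℝ) = ![lam / 2 * (x 1 * y 2 - x 2 * y 1),
      lam / 2 * (x 2 * y 0 - x 0 * y 2),
      lam / 2 * (x 0 * y 1 - x 1 * y 0),
      mu * (x 4 * y 4),
      -(mu * (x 4 * y 3))] := by
  funext i
  have h := hnab x y (EuclideanSpace.single i 1)
  rw [EuclideanSpace.inner_single_right] at h
  simp only [PiLp.inner_apply, hbr, Fin.sum_univ_five] at h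
  fin_cases i <;> simp at h ⊢ <;> rw [h] <;> ring

/-- The curvature tensor of the product of a round 3-sphere and a hyperbolic plane. -/
theorem su2_hyperbolic_curv_apply (lam mu : ℝ)
    (br nab : EuclideanSpace ℝ (Fin 5) → EuclideanSpace ℝ (Fin 5) →
      EuclideanSpace ℝ (Fin 5))
    (hbr : ∀ x y : EuclideanSpace ℝ (Fin 5),
      br x y = ![lam * (x 1 * y 2 - x 2 * y 1),
                  lam * (x 2 * y 0 - x 0 * y 2),
                  lam * (x 0 * y 1 - x 1 * y 0),
                  0,
                  mu * (x 3 * y 4 - x 4 * y 3)])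
    (hnab : IsLeviCivita br nab) (x y z w : EuclideanSpace ℝ (Fin 5)) :
    curv br nab x y z w =
      lam ^ 2 / 4 * ((x 0 * w 0 + x 1 * w 1 + x 2 * w 2) * (y 0 * z 0 + y 1 * z 1 + y 2 * z 2)
        - (x 0 * z 0 + x 1 * z 1 + x 2 * z 2) * (y 0 * w 0 + y 1 * w 1 + y 2 * w 2))
      - mu ^ 2 * ((x 3 * y 4 - x 4 * y 3) * (w 3 * z 4 - w 4 * z 3)) := by
  simp only [curv, curvOp, PiLp.inner_apply, Fin.sum_univ_five, PiLp.sub_apply,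
    su2_hyperbolic_nab_apply lam mu br nab hbr hnab, hbr]
  simp
  ring

/-- The form `Ř` of the product of a round 3-sphere and a hyperbolic plane. -/
theorem su2_hyperbolic_checkR_apply (lam mu : ℝ)
    (br nab : EuclideanSpace ℝ (Fin 5) → EuclideanSpace ℝ (Fin 5) →
      EuclideanSpace ℝ (Fin 5))
    (hbr : ∀ x y : EuclideanSpace ℝ (Fin 5),
      br x y = ![lam * (x 1 * y 2 - x 2 * y 1),
                  lam * (x 2 * y 0 - x 0 * y 2),
                  lam * (x 0 * y 1 - x 1 * y 0),
                  0,
                  mu * (x 3 * y 4 - x 4 * y 3)])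
    (hnab : IsLeviCivita br nab) (x y : EuclideanSpace ℝ (Fin 5)) :
    checkR br nab (EuclideanSpace.basisFun (Fin 5) ℝ) x y =
      lam ^ 4 / 4 * (x 0 * y 0 + x 1 * y 1 + x 2 * y 2)
        + 2 * mu ^ 4 * (x 3 * y 3 + x 4 * y 4) := by
  simp only [checkR, su2_hyperbolic_curv_apply lam mu br nab hbr hnab, Fin.sum_univ_five,
    EuclideanSpace.basisFun_apply, PiLp.single_apply]
  simp
  ring

/-- For `λ ≠ 0` and `μ > 0` with `μ² = (√2/4)·λ²`, the metric
Lie algebra on `ℝ⁵` (standard orthonormal basis `e_1, e_2, e_3, f_1, f_2` at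
coordinates `0,…,4`) with nonzero brackets `[e_1,e_2] = λe_3`,
`[e_2,e_3] = λe_1`, `[e_3,e_1] = λe_2`, `[f_1,f_2] = μf_2` is weakly Einstein
but not Einstein. -/
theorem su2_hyperbolic_product_weaklyEinstein_not_einstein
    (lam mu : ℝ) (hlam : lam ≠ 0) (hmu : 0 < mu)
    (hrel : mu ^ 2 = (Real.sqrt 2 / 4) * lam ^ 2)
    (br nab : EuclideanSpace ℝ (Fin 5) → EuclideanSpace ℝ (Fin 5) →
      EuclideanSpace ℝ (Fin 5))
    (hbr : ∀ x y : EuclideanSpace ℝ (Fin 5),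
      br x y = ![lam * (x 1 * y 2 - x 2 * y 1),
                  lam * (x 2 * y 0 - x 0 * y 2),
                  lam * (x 0 * y 1 - x 1 * y 0),
                  0,
                  mu * (x 3 * y 4 - x 4 * y 3)])
    (hnab : IsLeviCivita br nab) :
    WeaklyEinstein br nab (EuclideanSpace.basisFun (Fin 5) ℝ) ∧
      ¬ IsEinstein br nab (EuclideanSpace.basisFun (Fin 5) ℝ) := by
  have hsqrt : Real.sqrt 2 ^ 2 = 2 := Real.sq_sqrt (by norm_num)
  have hmu4 : 2 * mu ^ 4 = lam ^ 4 / 4 := by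
    linear_combination 2 * (mu ^ 2 + Real.sqrt 2 / 4 * lam ^ 2) * hrel + lam ^ 4 / 8 * hsqrt
  constructor
  · have key : ∀ x y : EuclideanSpace ℝ (Fin 5),
        checkR br nab (EuclideanSpace.basisFun (Fin 5) ℝ) x y = lam ^ 4 / 4 * ⟪x, y⟫_ℝ := by
      intro x y
      rw [su2_hyperbolic_checkR_apply lam mu br nab hbr hnab, hmu4]
      simp [PiLp.inner_apply, Fin.sum_univ_five]
      ring
    intro x y
    simp only [key]
    simp
  · rintro ⟨κ, hκ⟩
    have h0 := hκ (EuclideanSpace.single 0 1) (EuclideanSpace.single 0 1)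
    have h3 := hκ (EuclideanSpace.single 3 1) (EuclideanSpace.single 3 1)
    simp only [ricci, su2_hyperbolic_curv_apply lam mu br nab hbr hnab, Fin.sum_univ_five,
      EuclideanSpace.basisFun_apply, PiLp.single_apply] at h0 h3
    simp at h0 h3
    have hlam2 : 0 < lam ^ 2 := by positivity
    have hmu2 : 0 < mu ^ 2 := by positivity
    linarith
end
end

section
/- Let (𝔤,⟨·,·⟩) be a metric Lie algebra of dimension n ≥ 2 containing an abelian ideal 𝔞 of codimension 1, let e be a unit vector orthogonal to 𝔞, Q = ad(e)|_𝔞, and S = (1/2)(Q+Qᵗ) its symmetric part. Then (𝔤,⟨·,·⟩) is Einstein if and only if S is a scalar multiple of the identity on 𝔞. -/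
open Module
open scoped InnerProductSpace BigOperators

noncomputable section

variable {V : Type*} [NormedAddCommGroup V] [InnerProductSpace ℝ V]

/-- A Lie bracket as a bilinear map. -/
def IsLieBracket.toLin {br : V → V → V} (h : IsLieBracket br) : V →ₗ[ℝ] V →ₗ[ℝ] V :=
  LinearMap.mk₂ ℝ br h.add_left h.smul_left
    (fun X Y Z ↦ by rw [h.antisymm, h.add_left, neg_add, ← h.antisymm, ← h.antisymm])
    (fun c X Y ↦ by rw [h.antisymm, h.smul_left, ← smul_neg, ← h.antisymm])

@[simp]
lemma IsLieBracket.toLin_apply {br : V → V → V} (h : IsLieBracket br) (X Y : V) :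
    h.toLin X Y = br X Y := rfl

lemma IsLieBracket.bracket_self {br : V → V → V} (h : IsLieBracket br) (X : V) : br X X = 0 := by
  have := h.antisymm X X
  rw [← sub_eq_zero, sub_neg_eq_add, ← two_smul ℝ] at this
  exact (smul_eq_zero.1 this).resolve_left two_ne_zero

/-- The Levi-Civita product as a bilinear map. -/
def IsLeviCivita.toLin {br nab : V → V → V} (h : IsLeviCivita br nab) (hbr : IsLieBracket br) :
    V →ₗ[ℝ] V →ₗ[ℝ] V :=
  LinearMap.mk₂ ℝ nab
    (fun X Y Z ↦ ext_inner_right ℝ fun W ↦ by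
      simp only [h _ _ _, inner_add_left, ← hbr.toLin_apply, map_add, LinearMap.add_apply,
        inner_add_right]
      ring)
    (fun c X Y ↦ ext_inner_right ℝ fun W ↦ by
      simp only [h _ _ _, inner_smul_left, ← hbr.toLin_apply, map_smul, LinearMap.smul_apply,
        inner_smul_right, RCLike.conj_to_real]
      ring)
    (fun X Y Z ↦ ext_inner_right ℝ fun W ↦ by
      simp only [h _ _ _, inner_add_left, ← hbr.toLin_apply, map_add, LinearMap.add_apply,
        inner_add_right]
      ring)
    (fun c X Y ↦ ext_inner_right ℝ fun W ↦ by
      simp only [h _ _ _, inner_smul_left, ← hbr.toLin_apply, map_smul, LinearMap.smul_apply,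
        inner_smul_right, RCLike.conj_to_real]
      ring)

@[simp]
lemma IsLeviCivita.toLin_apply {br nab : V → V → V} (h : IsLeviCivita br nab)
    (hbr : IsLieBracket br) (X Y : V) : h.toLin hbr X Y = nab X Y := rfl

/-- The curvature operator as a linear map of its first argument. -/
def curvOpLin {br nab : V → V → V} (hbr : IsLieBracket br) (hnab : IsLeviCivita br nab)
    (X Y : V) : V →ₗ[ℝ] V where
  toFun Z := curvOp br nab Z X Y
  map_add' Z W := by
    simp only [curvOp, ← hnab.toLin_apply hbr, ← hbr.toLin_apply, map_add, LinearMap.add_apply]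
    abel
  map_smul' c Z := by
    simp only [curvOp, ← hnab.toLin_apply hbr, ← hbr.toLin_apply, map_smul, LinearMap.smul_apply,
      RingHom.id_apply, smul_sub]

/-- The Ricci form is the trace of the curvature operator. -/
lemma ricci_eq_trace {br nab : V → V → V} (hbr : IsLieBracket br) (hnab : IsLeviCivita br nab)
    {ι : Type*} [Fintype ι] (b : OrthonormalBasis ι ℝ V) (X Y : V) :
    ricci br nab b X Y = LinearMap.trace ℝ V (curvOpLin hbr hnab X Y) := by
  rw [LinearMap.trace_eq_sum_inner _ b]
  exact Finset.sum_congr rfl fun a _ ↦ real_inner_comm _ _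

/-- The Ricci form as a bilinear map. -/
def ricciLin {br nab : V → V → V} (hbr : IsLieBracket br) (hnab : IsLeviCivita br nab)
    {ι : Type*} [Fintype ι] (b : OrthonormalBasis ι ℝ V) : V →ₗ[ℝ] V →ₗ[ℝ] ℝ :=
  LinearMap.mk₂ ℝ (ricci br nab b)
    (fun X Y Z ↦ by
      simp only [ricci, curv, ← Finset.sum_add_distrib, ← inner_add_left]
      refine Finset.sum_congr rfl fun a _ ↦ congrArg (⟪·, b a⟫_ℝ) ?_
      simp only [curvOp, ← hnab.toLin_apply hbr, ← hbr.toLin_apply, map_add, LinearMap.add_apply]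
      abel)
    (fun c X Y ↦ by
      simp only [ricci, curv, smul_eq_mul, Finset.mul_sum, ← real_inner_smul_left]
      refine Finset.sum_congr rfl fun a _ ↦ congrArg (⟪·, b a⟫_ℝ) ?_
      simp only [curvOp, ← hnab.toLin_apply hbr, ← hbr.toLin_apply, map_smul,
        LinearMap.smul_apply, smul_sub])
    (fun X Y Z ↦ by
      simp only [ricci, curv, ← Finset.sum_add_distrib, ← inner_add_left]
      refine Finset.sum_congr rfl fun a _ ↦ congrArg (⟪·, b a⟫_ℝ) ?_
      simp only [curvOp, ← hnab.toLin_apply hbr, map_add]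
      abel)
    (fun c X Y ↦ by
      simp only [ricci, curv, smul_eq_mul, Finset.mul_sum, ← real_inner_smul_left]
      refine Finset.sum_congr rfl fun a _ ↦ congrArg (⟪·, b a⟫_ℝ) ?_
      simp only [curvOp, ← hnab.toLin_apply hbr, map_smul, smul_sub])

@[simp]
lemma ricciLin_apply {br nab : V → V → V} (hbr : IsLieBracket br) (hnab : IsLeviCivita br nab)
    {ι : Type*} [Fintype ι] (b : OrthonormalBasis ι ℝ V) (X Y : V) :
    ricciLin hbr hnab b X Y = ricci br nab b X Y := rfl

/-- The symmetric part of an endomorphism. -/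
def symmPart {E : Type*} [NormedAddCommGroup E] [InnerProductSpace ℝ E] [FiniteDimensional ℝ E]
    (Q : E →ₗ[ℝ] E) : E →ₗ[ℝ] E :=
  (1 / 2 : ℝ) • (Q + LinearMap.adjoint Q)

/-- The skew-symmetric part of an endomorphism. -/
def skewPart {E : Type*} [NormedAddCommGroup E] [InnerProductSpace ℝ E] [FiniteDimensional ℝ E]
    (Q : E →ₗ[ℝ] E) : E →ₗ[ℝ] E :=
  (1 / 2 : ℝ) • (Q - LinearMap.adjoint Q)

section Parts

variable {E : Type*} [NormedAddCommGroup E] [InnerProductSpace ℝ E] [FiniteDimensional ℝ E]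

lemma symmPart_add_skewPart (Q : E →ₗ[ℝ] E) : symmPart Q + skewPart Q = Q := by
  simp only [symmPart, skewPart]
  module

lemma inner_symmPart (Q : E →ₗ[ℝ] E) (x y : E) :
    ⟪symmPart Q x, y⟫_ℝ = (1 / 2) * (⟪Q x, y⟫_ℝ + ⟪Q y, x⟫_ℝ) := by
  rw [symmPart, LinearMap.smul_apply, real_inner_smul_left, LinearMap.add_apply, inner_add_left,
    LinearMap.adjoint_inner_left, real_inner_comm x]

lemma inner_skewPart (Q : E →ₗ[ℝ] E) (x y : E) :
    ⟪skewPart Q x, y⟫_ℝ = (1 / 2) * (⟪Q x, y⟫_ℝ - ⟪Q y, x⟫_ℝ) := by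
  rw [skewPart, LinearMap.smul_apply, real_inner_smul_left, LinearMap.sub_apply, inner_sub_left,
    LinearMap.adjoint_inner_left, real_inner_comm x]

lemma inner_symmPart_comm (Q : E →ₗ[ℝ] E) (x y : E) :
    ⟪symmPart Q x, y⟫_ℝ = ⟪x, symmPart Q y⟫_ℝ := by
  rw [real_inner_comm (symmPart Q y), inner_symmPart, inner_symmPart, add_comm]

lemma inner_skewPart_comm (Q : E →ₗ[ℝ] E) (x y : E) :
    ⟪skewPart Q x, y⟫_ℝ = -⟪x, skewPart Q y⟫_ℝ := by
  rw [real_inner_comm (skewPart Q y), inner_skewPart, inner_skewPart]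
  ring

lemma trace_symmetric_sq_eq_zero_iff {T : E →ₗ[ℝ] E} (hT : T.IsSymmetric) :
    LinearMap.trace ℝ E (T ∘ₗ T) = 0 ↔ T = 0 := by
  refine ⟨fun h ↦ ?_, fun h ↦ by simp [h]⟩
  let b := stdOrthonormalBasis ℝ E
  rw [LinearMap.trace_eq_sum_inner _ b] at h
  simp only [LinearMap.comp_apply, ← hT _ (T _)] at h
  rw [Finset.sum_eq_zero_iff_of_nonneg fun i _ ↦ real_inner_self_nonneg] at h
  exact b.toBasis.ext fun i ↦ by simpa using h i (Finset.mem_univ i)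

/-- Equality case of the Cauchy–Schwarz inequality for the trace form. -/
lemma exists_eq_smul_id_of_trace_sq {T : E →ₗ[ℝ] E} (hT : T.IsSymmetric)
    (hE : finrank ℝ E ≠ 0)
    (h : LinearMap.trace ℝ E T ^ 2 = finrank ℝ E * LinearMap.trace ℝ E (T ∘ₗ T)) :
    ∃ c : ℝ, T = c • LinearMap.id := by
  have hE' : (finrank ℝ E : ℝ) ≠ 0 := by exact_mod_cast hE
  set c := LinearMap.trace ℝ E T / finrank ℝ E with hc
  refine ⟨c, sub_eq_zero.1 ((trace_symmetric_sq_eq_zero_iff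
    (hT.sub (LinearMap.IsSymmetric.id.smul (by simp)))).1 ?_)⟩
  have : (T - c • LinearMap.id) ∘ₗ (T - c • LinearMap.id) =
      T ∘ₗ T - (2 * c) • T + c ^ 2 • LinearMap.id := by
    ext x
    simp only [LinearMap.comp_apply, LinearMap.sub_apply, LinearMap.smul_apply, map_sub, map_smul,
      LinearMap.add_apply, LinearMap.id_apply]
    module
  rw [this, map_add, map_sub, map_smul, map_smul, LinearMap.trace_id, smul_eq_mul, smul_eq_mul, hc]
  field_simp
  linear_combination -h

end Parts

/-- A bracket with abelian ideal `𝔞` orthogonal to the unit vector `e`, on which `e` acts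
by `Q`. -/
structure IsAlmostAbelian (br : V → V → V) (𝔞 : Submodule ℝ V) (e : V) (Q : 𝔞 →ₗ[ℝ] 𝔞) :
    Prop where
  bracket_eq_zero : ∀ x y : 𝔞, br x y = 0
  norm_eq_one : ‖e‖ = 1
  inner_eq_zero : ∀ x : 𝔞, ⟪e, (x : V)⟫_ℝ = 0
  bracket_left : ∀ x : 𝔞, br e x = Q x
  finrank_eq : finrank ℝ 𝔞 + 1 = finrank ℝ V

namespace IsAlmostAbelian

variable {br nab : V → V → V} {𝔞 : Submodule ℝ V} {e : V} {Q : 𝔞 →ₗ[ℝ] 𝔞}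

lemma inner_eq_zero' (h : IsAlmostAbelian br 𝔞 e Q) (x : 𝔞) : ⟪(x : V), e⟫_ℝ = 0 := by
  rw [real_inner_comm, h.inner_eq_zero]

lemma inner_self (h : IsAlmostAbelian br 𝔞 e Q) : ⟪e, e⟫_ℝ = 1 := by
  simp [h.norm_eq_one]

lemma bracket_right (h : IsAlmostAbelian br 𝔞 e Q) (hbr : IsLieBracket br) (x : 𝔞) :
    br x e = -(Q x : V) := by
  rw [hbr.antisymm, h.bracket_left]

lemma orthonormal (h : IsAlmostAbelian br 𝔞 e Q) {ι : Type*} [Fintype ι]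
    (b : OrthonormalBasis ι ℝ 𝔞) :
    Orthonormal ℝ (fun i : Option ι ↦ i.elim e (fun j ↦ (b j : V))) := by
  classical
  rw [orthonormal_iff_ite]
  rintro (_ | i) (_ | j)
  · simp [h.norm_eq_one]
  · simp [h.inner_eq_zero]
  · simp [h.inner_eq_zero']
  · simpa using orthonormal_iff_ite.1 b.orthonormal i j

variable [FiniteDimensional ℝ V]

/-- The unit vector `e` extends an orthonormal basis of `𝔞` to one of the whole space. -/
lemma exists_basis (h : IsAlmostAbelian br 𝔞 e Q) {ι : Type*} [Fintype ι]
    (b : OrthonormalBasis ι ℝ 𝔞) :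
    ∃ B : OrthonormalBasis (Option ι) ℝ V, B none = e ∧ ∀ i, B (some i) = b i := by
  have hcard : Fintype.card (Option ι) = finrank ℝ V := by
    rw [Fintype.card_option, ← finrank_eq_card_basis b.toBasis, h.finrank_eq]
  let B := OrthonormalBasis.mk (h.orthonormal b)
    ((h.orthonormal b).linearIndependent.span_eq_top_of_card_eq_finrank' hcard).ge
  exact ⟨B, by simp [B], by simp [B]⟩

lemma exists_decomp (h : IsAlmostAbelian br 𝔞 e Q) (X : V) :
    ∃ (t : ℝ) (x : 𝔞), X = t • e + x := by
  obtain ⟨B, hB, hB'⟩ := h.exists_basis (stdOrthonormalBasis ℝ 𝔞)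
  refine ⟨⟪e, X⟫_ℝ, ∑ i, ⟪B (some i), X⟫_ℝ • stdOrthonormalBasis ℝ 𝔞 i, ?_⟩
  conv_lhs => rw [← B.sum_repr' X, Fintype.sum_option, hB]
  simp [hB']

lemma ext (h : IsAlmostAbelian br 𝔞 e Q) {X Y : V} (he : ⟪X, e⟫_ℝ = ⟪Y, e⟫_ℝ)
    (ha : ∀ z : 𝔞, ⟪X, (z : V)⟫_ℝ = ⟪Y, (z : V)⟫_ℝ) : X = Y := by
  refine ext_inner_right ℝ fun Z ↦ ?_
  obtain ⟨t, z, rfl⟩ := h.exists_decomp Z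
  simp only [inner_add_right, real_inner_smul_right, he, ha]

lemma nab_self (h : IsAlmostAbelian br 𝔞 e Q) (hbr : IsLieBracket br)
    (hnab : IsLeviCivita br nab) : nab e e = 0 := by
  refine h.ext ?_ fun z ↦ ?_
  · simp [hnab e e e, hbr.bracket_self]
  · simp [hnab e e z, hbr.bracket_self, h.bracket_left, h.bracket_right hbr, h.inner_eq_zero']

lemma nab_left (h : IsAlmostAbelian br 𝔞 e Q) (hbr : IsLieBracket br)
    (hnab : IsLeviCivita br nab) (x : 𝔞) : nab e x = skewPart Q x := by
  refine h.ext ?_ fun z ↦ ?_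
  · simp [hnab e x e, hbr.bracket_self, h.bracket_left, h.bracket_right hbr, h.inner_eq_zero']
  · rw [hnab e x z, h.bracket_left, h.bracket_eq_zero, h.bracket_right hbr, ← 𝔞.coe_inner (skewPart Q x),
      inner_skewPart]
    simp [sub_eq_add_neg]

lemma nab_right (h : IsAlmostAbelian br 𝔞 e Q) (hbr : IsLieBracket br)
    (hnab : IsLeviCivita br nab) (x : 𝔞) : nab x e = -(symmPart Q x : V) := by
  refine h.ext ?_ fun z ↦ ?_
  · simp [hnab x e e, hbr.bracket_self, h.bracket_left, h.bracket_right hbr, h.inner_eq_zero']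
  · rw [hnab x e z, h.bracket_left, h.bracket_eq_zero, h.bracket_right hbr, inner_neg_left,
      inner_neg_left, ← 𝔞.coe_inner (symmPart Q x), inner_symmPart]
    simp
    ring

lemma nab_mem (h : IsAlmostAbelian br 𝔞 e Q) (hbr : IsLieBracket br)
    (hnab : IsLeviCivita br nab) (x y : 𝔞) : nab x y = ⟪symmPart Q x, y⟫_ℝ • e := by
  refine h.ext ?_ fun z ↦ ?_
  · rw [hnab x y e, h.bracket_left, h.bracket_eq_zero, h.bracket_right hbr, real_inner_smul_left,
      h.inner_self, inner_symmPart]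
    simp
    ring
  · simp [hnab x y z, h.bracket_eq_zero, real_inner_smul_left, h.inner_eq_zero]

lemma trace_eq (h : IsAlmostAbelian br 𝔞 e Q) {ι : Type*} [Fintype ι]
    (b : OrthonormalBasis ι ℝ 𝔞) (T : V →ₗ[ℝ] V) :
    LinearMap.trace ℝ V T = ⟪T e, e⟫_ℝ + ∑ i, ⟪T (b i), (b i : V)⟫_ℝ := by
  obtain ⟨B, hB, hB'⟩ := h.exists_basis b
  simp [LinearMap.trace_eq_sum_inner T B, Fintype.sum_option, hB, hB', real_inner_comm]

variable {ι : Type*} [Fintype ι]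

lemma ricci_self_self (h : IsAlmostAbelian br 𝔞 e Q) (hbr : IsLieBracket br)
    (hnab : IsLeviCivita br nab) (b : OrthonormalBasis ι ℝ V) :
    ricci br nab b e e = -LinearMap.trace ℝ 𝔞 (symmPart Q ∘ₗ symmPart Q) := by
  have key (x : 𝔞) : curvOp br nab x e e =
      ((skewPart Q (symmPart Q x) - symmPart Q (Q x) : 𝔞) : V) := by
    simp only [curvOp, h.nab_self hbr hnab, h.nab_right hbr hnab, h.bracket_right hbr]
    simp only [← hnab.toLin_apply hbr, map_neg, map_zero, LinearMap.neg_apply]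
    simp [h.nab_left hbr hnab, h.nab_right hbr hnab]
  have htr : LinearMap.trace ℝ 𝔞 (skewPart Q ∘ₗ symmPart Q - symmPart Q ∘ₗ Q) =
      -LinearMap.trace ℝ 𝔞 (symmPart Q ∘ₗ symmPart Q) := by
    have hQ : symmPart Q ∘ₗ Q = symmPart Q ∘ₗ symmPart Q + symmPart Q ∘ₗ skewPart Q := by
      rw [← LinearMap.comp_add, symmPart_add_skewPart]
    rw [hQ, map_sub, map_add, LinearMap.trace_comp_comm']
    ring
  rw [ricci_eq_trace hbr hnab, h.trace_eq (stdOrthonormalBasis ℝ 𝔞), ← htr,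
    LinearMap.trace_eq_sum_inner _ (stdOrthonormalBasis ℝ 𝔞)]
  simp only [curvOpLin, LinearMap.coe_mk, AddHom.coe_mk, key]
  have hee : curvOp br nab e e e = 0 := by
    simp [curvOp, hbr.bracket_self, ← hnab.toLin_apply hbr, -IsLeviCivita.toLin_apply]
  simp [hee, real_inner_comm]

lemma ricci_self_mem (h : IsAlmostAbelian br 𝔞 e Q) (hbr : IsLieBracket br)
    (hnab : IsLeviCivita br nab) (b : OrthonormalBasis ι ℝ V) (y : 𝔞) :
    ricci br nab b e y = 0 := by
  have key (x : 𝔞) : curvOp br nab x e y =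
      (⟪symmPart Q x, skewPart Q y⟫_ℝ + ⟪symmPart Q (Q x), y⟫_ℝ) • e := by
    simp only [curvOp, h.nab_left hbr hnab, h.nab_mem hbr hnab, h.bracket_right hbr]
    simp only [← hnab.toLin_apply hbr, map_neg, map_smul, LinearMap.neg_apply]
    simp [h.nab_self hbr hnab, h.nab_mem hbr hnab, add_smul]
  rw [ricci_eq_trace hbr hnab, h.trace_eq (stdOrthonormalBasis ℝ 𝔞)]
  simp only [curvOpLin, LinearMap.coe_mk, AddHom.coe_mk, key]
  have hee : curvOp br nab e e y = 0 := by
    simp [curvOp, hbr.bracket_self, ← hnab.toLin_apply hbr, -IsLeviCivita.toLin_apply]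
  simp [hee, real_inner_smul_left, h.inner_eq_zero]

lemma ricci_mem_self (h : IsAlmostAbelian br 𝔞 e Q) (hbr : IsLieBracket br)
    (hnab : IsLeviCivita br nab) (b : OrthonormalBasis ι ℝ V) (x : 𝔞) :
    ricci br nab b x e = 0 := by
  have key (z : 𝔞) : curvOp br nab z x e = 0 := by
    simp only [curvOp, h.nab_right hbr hnab, h.bracket_eq_zero]
    simp only [← hnab.toLin_apply hbr, map_neg, map_zero, LinearMap.zero_apply]
    simp [h.nab_mem hbr hnab, real_inner_comm]
  have key' : curvOp br nab e x e =
      ((symmPart Q (Q x) - skewPart Q (symmPart Q x) : 𝔞) : V) := by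
    simp only [curvOp, h.nab_self hbr hnab, h.nab_right hbr hnab, h.bracket_left]
    simp only [← hnab.toLin_apply hbr, map_neg, map_zero]
    simp [h.nab_left hbr hnab]
    abel
  rw [ricci_eq_trace hbr hnab, h.trace_eq (stdOrthonormalBasis ℝ 𝔞)]
  simp only [curvOpLin, LinearMap.coe_mk, AddHom.coe_mk, key, key', h.inner_eq_zero']
  simp

lemma ricci_mem_mem (h : IsAlmostAbelian br 𝔞 e Q) (hbr : IsLieBracket br)
    (hnab : IsLeviCivita br nab) (b : OrthonormalBasis ι ℝ V) (x y : 𝔞) :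
    ricci br nab b x y = ⟪(skewPart Q ∘ₗ symmPart Q - symmPart Q ∘ₗ skewPart Q -
      LinearMap.trace ℝ 𝔞 (symmPart Q) • symmPart Q) x, y⟫_ℝ := by
  have key (z : 𝔞) : curvOp br nab z x y =
      ((⟪symmPart Q z, y⟫_ℝ • symmPart Q x - ⟪symmPart Q x, y⟫_ℝ • symmPart Q z : 𝔞) : V) := by
    simp only [curvOp, h.nab_mem hbr hnab, h.bracket_eq_zero]
    simp only [← hnab.toLin_apply hbr, map_smul, map_zero, LinearMap.zero_apply]
    simp [h.nab_right hbr hnab]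
    abel
  have key' : curvOp br nab e x y =
      (-⟪symmPart Q x, skewPart Q y⟫_ℝ - ⟪symmPart Q (Q x), y⟫_ℝ) • e := by
    simp only [curvOp, h.nab_left hbr hnab, h.nab_mem hbr hnab, h.bracket_left]
    simp only [← hnab.toLin_apply hbr, map_smul]
    simp [h.nab_self hbr hnab, sub_smul]
  have hsum : ∑ i, ⟪symmPart Q (stdOrthonormalBasis ℝ 𝔞 i), y⟫_ℝ *
      ⟪symmPart Q x, stdOrthonormalBasis ℝ 𝔞 i⟫_ℝ = ⟪symmPart Q (symmPart Q x), y⟫_ℝ := by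
    simp only [inner_symmPart_comm Q _ y, mul_comm, OrthonormalBasis.sum_inner_mul_inner]
  have hQ : symmPart Q (Q x) = symmPart Q (symmPart Q x) + symmPart Q (skewPart Q x) := by
    rw [← map_add, ← LinearMap.add_apply, symmPart_add_skewPart]
  rw [ricci_eq_trace hbr hnab, h.trace_eq (stdOrthonormalBasis ℝ 𝔞)]
  simp only [curvOpLin, LinearMap.coe_mk, AddHom.coe_mk, key, key', ← Submodule.coe_inner,
    inner_sub_left, real_inner_smul_left, Finset.sum_sub_distrib, hsum, h.inner_self, hQ,
    LinearMap.sub_apply, LinearMap.comp_apply, LinearMap.smul_apply, inner_add_left,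
    inner_skewPart_comm Q _ y, LinearMap.trace_eq_sum_inner _ (stdOrthonormalBasis ℝ 𝔞),
    ← Finset.mul_sum]
  simp only [real_inner_comm]
  ring

lemma isEinstein_iff (h : IsAlmostAbelian br 𝔞 e Q) (hbr : IsLieBracket br)
    (hnab : IsLeviCivita br nab) (b : OrthonormalBasis ι ℝ V) :
    IsEinstein br nab b ↔
      skewPart Q ∘ₗ symmPart Q - symmPart Q ∘ₗ skewPart Q -
        LinearMap.trace ℝ 𝔞 (symmPart Q) • symmPart Q =
      -LinearMap.trace ℝ 𝔞 (symmPart Q ∘ₗ symmPart Q) • LinearMap.id := by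
  constructor
  · rintro ⟨κ, hκ⟩
    have hκ' : κ = -LinearMap.trace ℝ 𝔞 (symmPart Q ∘ₗ symmPart Q) := by
      rw [← h.ricci_self_self hbr hnab b, hκ, h.inner_self, mul_one]
    refine LinearMap.ext fun x ↦ ext_inner_right ℝ fun y ↦ ?_
    rw [← h.ricci_mem_mem hbr hnab b, hκ, ← hκ', LinearMap.smul_apply, real_inner_smul_left]
    rfl
  · intro heq
    refine ⟨-LinearMap.trace ℝ 𝔞 (symmPart Q ∘ₗ symmPart Q), fun X Y ↦ ?_⟩
    obtain ⟨s, x, rfl⟩ := h.exists_decomp X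
    obtain ⟨t, y, rfl⟩ := h.exists_decomp Y
    have hxy := h.ricci_mem_mem hbr hnab b x y
    rw [heq, LinearMap.smul_apply, real_inner_smul_left, LinearMap.id_apply] at hxy
    rw [← ricciLin_apply hbr hnab]
    simp only [map_add, map_smul, LinearMap.add_apply, LinearMap.smul_apply, ricciLin_apply,
      h.ricci_self_self hbr hnab, h.ricci_self_mem hbr hnab, h.ricci_mem_self hbr hnab, hxy,
      inner_add_left, inner_add_right, real_inner_smul_left, real_inner_smul_right, h.inner_self,
      h.inner_eq_zero, h.inner_eq_zero', Submodule.coe_inner, smul_eq_mul]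
    ring

end IsAlmostAbelian

/-- An almost abelian metric Lie algebra of dimension `n ≥ 2`
is Einstein if and only if the symmetric part `S = (1/2)(Q + Qᵗ)` of
`Q = ad(e)|_𝔞` is a scalar multiple of the identity on `𝔞`. -/
theorem einstein_almostAbelian_iff
    {V : Type*} [NormedAddCommGroup V] [InnerProductSpace ℝ V] [FiniteDimensional ℝ V]
    (n : ℕ) (hn : 2 ≤ n) (hdimV : finrank ℝ V = n)
    (br : V → V → V) (hbr : IsLieBracket br)
    (nab : V → V → V) (hnab : IsLeviCivita br nab)
    (𝔞 : Submodule ℝ V)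
    (hcodim : finrank ℝ 𝔞 + 1 = n)
    (habelian : ∀ X Y : V, X ∈ 𝔞 → Y ∈ 𝔞 → br X Y = 0)
    (hideal : ∀ X Y : V, Y ∈ 𝔞 → br X Y ∈ 𝔞)
    (e : V) (he : ‖e‖ = 1) (heorth : ∀ X ∈ 𝔞, ⟪e, X⟫_ℝ = 0)
    (Q : 𝔞 →ₗ[ℝ] 𝔞) (hQ : ∀ X : 𝔞, (Q X : V) = br e (X : V))
    (S : 𝔞 →ₗ[ℝ] 𝔞) (hS : S = (1 / 2 : ℝ) • (Q + LinearMap.adjoint Q))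
    (basis : OrthonormalBasis (Fin n) ℝ V) :
    IsEinstein br nab basis ↔ ∃ c : ℝ, S = c • LinearMap.id := by
  subst hS
  have h : IsAlmostAbelian br 𝔞 e Q :=
    ⟨fun x y ↦ habelian x y x.2 y.2, he, fun x ↦ heorth x x.2, fun x ↦ (hQ x).symm,
      hcodim.trans hdimV.symm⟩
  rw [h.isEinstein_iff hbr hnab]
  change _ ↔ ∃ c : ℝ, symmPart Q = c • LinearMap.id
  constructor
  · intro heq
    refine exists_eq_smul_id_of_trace_sq (inner_symmPart_comm Q) (by omega) ?_
    have := congrArg (LinearMap.trace ℝ 𝔞) heq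
    rw [map_sub, map_sub, LinearMap.trace_comp_comm', map_smul, map_smul, LinearMap.trace_id] at this
    simp only [smul_eq_mul] at this
    linear_combination -this
  · rintro ⟨c, hc⟩
    rw [hc]
    refine LinearMap.ext fun x ↦ ?_
    simp only [LinearMap.smul_comp, LinearMap.comp_smul, LinearMap.id_comp, LinearMap.comp_id,
      map_smul, LinearMap.sub_apply, LinearMap.smul_apply, LinearMap.id_apply, smul_eq_mul]
    module
end
end

section
/- Let (𝔤,⟨·,·⟩) be a metric Lie algebra containing an abelian ideal 𝔞 of codimension 1, let e be a unit vector orthogonal to 𝔞, Q = ad(e)|_𝔞, S = (1/2)(Q+Qᵗ), K = (1/2)(Q−Qᵗ), and P = [S,K] + S². Then for all X, Y, Z ∈ 𝔞 the Levi–Civita product satisfies ∇_e e = 0, ∇_e X = KX, ∇_X e = −SX, ∇_X Y = ⟨SX,Y⟩·e, and the curvature satisfies R(X,Y)Z = ⟨SX,Z⟩·SY − ⟨SY,Z⟩·SX and R(e,X)Y = −⟨PX,Y⟩·e. -/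
open Module
open scoped InnerProductSpace BigOperators

noncomputable section

variable {V : Type*} [NormedAddCommGroup V] [InnerProductSpace ℝ V]

namespace IsLieBracket

variable {br : V → V → V}

theorem self_eq_zero (h : IsLieBracket br) (X : V) : br X X = 0 := by
  have h2 : (2 : ℝ) • br X X = 0 := by
    rw [two_smul]
    exact add_eq_zero_iff_eq_neg.mpr (h.antisymm X X)
  simpa using h2

theorem smul_right (h : IsLieBracket br) (c : ℝ) (X Y : V) : br X (c • Y) = c • br X Y := by
  rw [h.antisymm, h.smul_left, h.antisymm X Y, smul_neg]

end IsLieBracket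

namespace IsLeviCivita

variable {br nab : V → V → V}

theorem smul_left (h : IsLeviCivita br nab) (hbr : IsLieBracket br) (c : ℝ) (X Y : V) :
    nab (c • X) Y = c • nab X Y := by
  refine ext_inner_right ℝ fun Z => ?_
  simp only [h _ _ _, inner_smul_left, inner_smul_right, hbr.smul_left, hbr.smul_right,
    conj_trivial]
  ring

theorem smul_right (h : IsLeviCivita br nab) (hbr : IsLieBracket br) (c : ℝ) (X Y : V) :
    nab X (c • Y) = c • nab X Y := by
  refine ext_inner_right ℝ fun Z => ?_
  simp only [h _ _ _, inner_smul_left, inner_smul_right, hbr.smul_left, hbr.smul_right,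
    conj_trivial]
  ring

theorem zero_left (h : IsLeviCivita br nab) (hbr : IsLieBracket br) (Y : V) : nab 0 Y = 0 := by
  simpa using h.smul_left hbr 0 0 Y

end IsLeviCivita

/-- A vector is determined by its inner products with a hyperplane and with a unit normal. -/
theorem eq_of_inner_hyperplane_of_inner_normal [FiniteDimensional ℝ V] {𝔞 : Submodule ℝ V}
    (hcodim : finrank ℝ 𝔞 + 1 = finrank ℝ V) {e : V} (he : ‖e‖ = 1)
    (heorth : ∀ X ∈ 𝔞, ⟪e, X⟫_ℝ = 0) {v w : V} (h𝔞 : ∀ Z : 𝔞, ⟪v, (Z : V)⟫_ℝ = ⟪w, (Z : V)⟫_ℝ)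
    (hn : ⟪v, e⟫_ℝ = ⟪w, e⟫_ℝ) : v = w := by
  have hfin : finrank ℝ 𝔞ᗮ = 1 := by
    have := 𝔞.finrank_add_finrank_orthogonal
    omega
  have heo : e ∈ 𝔞ᗮ := (𝔞.mem_orthogonal' _).mpr heorth
  have hvw : v - w ∈ 𝔞ᗮ := (𝔞.mem_orthogonal' _).mpr fun Z hZ => by
    rw [inner_sub_left, h𝔞 ⟨Z, hZ⟩, sub_self]
  have he0 : (⟨e, heo⟩ : 𝔞ᗮ) ≠ 0 := by
    intro h
    have : e = 0 := congrArg Subtype.val h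
    simp [this] at he
  obtain ⟨c, hc⟩ := (finrank_eq_one_iff_of_nonzero' _ he0).mp hfin ⟨v - w, hvw⟩
  have hc' : c • e = v - w := congrArg Subtype.val hc
  have hc0 : c = 0 := by
    have : ⟪c • e, e⟫_ℝ = 0 := by rw [hc', inner_sub_left, hn, sub_self]
    simpa [inner_smul_left, he] using this
  rw [hc0, zero_smul] at hc'
  exact sub_eq_zero.mp hc'.symm

/-- In an almost abelian metric Lie algebra with abelian
codimension-1 ideal `𝔞`, unit vector `e ⟂ 𝔞`, `Q = ad(e)|_𝔞`,
`S = (1/2)(Q+Qᵗ)`, `K = (1/2)(Q−Qᵗ)`, `P = [S,K] + S²`, the Levi-Civita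
product satisfies `∇_e e = 0`, `∇_e X = KX`, `∇_X e = −SX`,
`∇_X Y = ⟨SX,Y⟩·e`, and the curvature operator satisfies
`R(X,Y)Z = ⟨SX,Z⟩·SY − ⟨SY,Z⟩·SX` and `R(e,X)Y = −⟨PX,Y⟩·e` for
`X, Y, Z ∈ 𝔞`. -/
theorem almostAbelian_connection_and_curvature
    {V : Type*} [NormedAddCommGroup V] [InnerProductSpace ℝ V] [FiniteDimensional ℝ V]
    (br : V → V → V) (hbr : IsLieBracket br)
    (nab : V → V → V) (hnab : IsLeviCivita br nab)
    (𝔞 : Submodule ℝ V)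
    (hcodim : finrank ℝ 𝔞 + 1 = finrank ℝ V)
    (habelian : ∀ X Y : V, X ∈ 𝔞 → Y ∈ 𝔞 → br X Y = 0)
    (hideal : ∀ X Y : V, Y ∈ 𝔞 → br X Y ∈ 𝔞)
    (e : V) (he : ‖e‖ = 1) (heorth : ∀ X ∈ 𝔞, ⟪e, X⟫_ℝ = 0)
    (Q : 𝔞 →ₗ[ℝ] 𝔞) (hQ : ∀ X : 𝔞, (Q X : V) = br e (X : V))
    (S : 𝔞 →ₗ[ℝ] 𝔞) (hS : S = (1 / 2 : ℝ) • (Q + LinearMap.adjoint Q))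
    (K : 𝔞 →ₗ[ℝ] 𝔞) (hK : K = (1 / 2 : ℝ) • (Q - LinearMap.adjoint Q))
    (P : 𝔞 →ₗ[ℝ] 𝔞) (hP : P = (S ∘ₗ K - K ∘ₗ S) + S ∘ₗ S) :
    nab e e = 0 ∧
      (∀ X : 𝔞, nab e (X : V) = (K X : V)) ∧
      (∀ X : 𝔞, nab (X : V) e = -((S X : V))) ∧
      (∀ X Y : 𝔞, nab (X : V) (Y : V) = ⟪S X, Y⟫_ℝ • e) ∧
      (∀ X Y Z : 𝔞, curvOp br nab (X : V) (Y : V) (Z : V)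
          = ⟪S X, Z⟫_ℝ • (S Y : V) - ⟪S Y, Z⟫_ℝ • (S X : V)) ∧
      (∀ X Y : 𝔞, curvOp br nab e (X : V) (Y : V) = -(⟪P X, Y⟫_ℝ • e)) := by
  have horth (X : 𝔞) : ⟪e, (X : V)⟫_ℝ = 0 := heorth X X.2
  have horth' (X : 𝔞) : ⟪(X : V), e⟫_ℝ = 0 := by rw [real_inner_comm, horth]
  have hee : ⟪e, e⟫_ℝ = 1 := by simp [he]
  have hbre (X : 𝔞) : br X e = -(Q X : V) := by rw [hbr.antisymm, hQ]
  have hbr0 (X Y : 𝔞) : br X Y = 0 := habelian X Y X.2 Y.2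
  have hSi (X Y : 𝔞) : ⟪S X, Y⟫_ℝ = 1 / 2 * (⟪Q X, Y⟫_ℝ + ⟪Q Y, X⟫_ℝ) := by
    simp only [hS, LinearMap.smul_apply, LinearMap.add_apply, inner_smul_left, inner_add_left,
      LinearMap.adjoint_inner_left, real_inner_comm X, conj_trivial]
  have hKi (X Y : 𝔞) : ⟪K X, Y⟫_ℝ = 1 / 2 * (⟪Q X, Y⟫_ℝ - ⟪Q Y, X⟫_ℝ) := by
    simp only [hK, LinearMap.smul_apply, LinearMap.sub_apply, inner_smul_left, inner_sub_left,
      LinearMap.adjoint_inner_left, real_inner_comm X, conj_trivial]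
  have hext {v w : V} := eq_of_inner_hyperplane_of_inner_normal hcodim he heorth (v := v) (w := w)
  have nab_e_e : nab e e = 0 := by
    refine hext (fun Z => ?_) ?_ <;>
      simp [hnab _ _ _, hbr.self_eq_zero, ← hQ, hbre, horth']
  have nab_e (X : 𝔞) : nab e X = (K X : V) := by
    refine hext (fun Z => ?_) ?_
    · rw [← Submodule.coe_inner, hKi, hnab, hbr0, hbre, ← hQ]
      simp only [inner_zero_left, inner_neg_left, Submodule.coe_inner]
      ring
    · simp [hnab _ _ _, hbr.self_eq_zero, ← hQ, hbre, horth']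
  have nab_X_e (X : 𝔞) : nab X e = -(S X : V) := by
    refine hext (fun Z => ?_) ?_
    · rw [inner_neg_left, ← Submodule.coe_inner, hSi, hnab, hbr0, hbre, ← hQ]
      simp only [inner_zero_left, inner_neg_left, Submodule.coe_inner]
      ring
    · simp [hnab _ _ _, hbr.self_eq_zero, ← hQ, hbre, horth']
  have nab_X_Y (X Y : 𝔞) : nab X Y = ⟪S X, Y⟫_ℝ • e := by
    refine hext (fun Z => ?_) ?_
    · simp [hnab _ _ _, hbr0, inner_smul_left, horth]
    · rw [inner_smul_left, hee, hSi, hnab, hbr0, hbre, ← hQ]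
      simp only [inner_zero_left, inner_neg_left, Submodule.coe_inner, conj_trivial]
      ring
  refine ⟨nab_e_e, nab_e, nab_X_e, nab_X_Y, fun X Y Z => ?_, fun X Y => ?_⟩
  · rw [curvOp, nab_X_Y, nab_X_Y, hnab.smul_right hbr, hnab.smul_right hbr, nab_X_e, nab_X_e,
      hbr0, hnab.zero_left hbr]
    module
  · have hQSK : Q X = S X + K X := by
      rw [hS, hK]
      simp only [LinearMap.smul_apply, LinearMap.add_apply, LinearMap.sub_apply]
      module
    have hKskew : ⟪K (S X), Y⟫_ℝ = -⟪S X, K Y⟫_ℝ := by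
      rw [real_inner_comm (K Y), hKi, hKi]
      ring
    rw [curvOp, nab_X_Y, hnab.smul_right hbr, nab_e_e, nab_e, nab_X_Y, ← hQ, nab_X_Y, hQSK, hP]
    simp only [LinearMap.add_apply, LinearMap.sub_apply, LinearMap.comp_apply, map_add,
      inner_add_left, inner_sub_left, hKskew]
    module
end
end

section
/- Let (𝔫,⟨·,·⟩) be a 2-step nilpotent metric Lie algebra, 𝔷 = [𝔫,𝔫] its derived algebra, and 𝔳 the orthogonal complement of 𝔷. For A ∈ 𝔷 define the skew-symmetric endomorphism J_A of 𝔳 by ⟨J_A X, Y⟩ = ⟨[X,Y], A⟩ for X,Y ∈ 𝔳. Fix orthonormal bases (e_a) of 𝔷 and (e_i) of 𝔳, write J_a = J_{e_a} and S_{ab} = −(1/2)(J_aJ_b + J_bJ_a). Then: Ř(X,A) = 0 for all X ∈ 𝔳, A ∈ 𝔷; Ř(e_a,e_b) = (1/8)·Σ_c Tr(3·S_{ab}S_{cc} − 2·S_{ac}S_{bc}) for all a, b; and Ř(X,Y) = (1/8)·Σ_{a,b} ⟨(4·S_{ab}² + 3·Tr(S_{ab})·S_{ab})X, Y⟩ for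 all X, Y ∈ 𝔳. -/
open Module
open scoped InnerProductSpace BigOperators

noncomputable section

variable {V : Type*} [NormedAddCommGroup V] [InnerProductSpace ℝ V]

section SkewFamily

variable {W : Type*} [NormedAddCommGroup W] [InnerProductSpace ℝ W]
  {κ ι : Type*} [Fintype κ] [Fintype ι]

theorem sum_sum_eq_of_add_swap_eq {F G : κ → κ → ℝ}
    (h : ∀ a b, F a b + F b a = G a b + G b a) :
    ∑ a, ∑ b, F a b = ∑ a, ∑ b, G a b := by
  have key : ∑ a, ∑ b, (F a b + F b a) = ∑ a, ∑ b, (G a b + G b a) := by simp only [h]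
  simp only [Finset.sum_add_distrib] at key
  rw [Finset.sum_comm (f := fun a b => F b a), Finset.sum_comm (f := fun a b => G b a)] at key
  linarith

theorem sum_inner_mul_inner_left (e : OrthonormalBasis ι ℝ W) (x y : W) :
    ∑ i, ⟪x, e i⟫_ℝ * ⟪y, e i⟫_ℝ = ⟪x, y⟫_ℝ := by
  rw [← e.sum_inner_mul_inner x y]
  simp only [real_inner_comm]

theorem sum_triple_sum_mul_sum (f g : κ → ι → ι → ι → ℝ) :
    ∑ i, ∑ j, ∑ k, (∑ a, f a i j k) * (∑ b, g b i j k)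
      = ∑ a, ∑ b, ∑ i, ∑ j, ∑ k, f a i j k * g b i j k := by
  have move : ∀ F : ι → κ → κ → ℝ, ∑ i, ∑ a, ∑ b, F i a b = ∑ a, ∑ b, ∑ i, F i a b :=
    fun F => Finset.sum_comm.trans (Finset.sum_congr rfl fun a _ => Finset.sum_comm)
  simp only [Finset.sum_mul_sum, move]

theorem sum_mul_inner_mul_mul_inner (e : OrthonormalBasis ι ℝ W) (r : ℝ) (x y : W) :
    ∑ i, (r * ⟪x, e i⟫_ℝ) * (r * ⟪y, e i⟫_ℝ) = r * r * ⟪x, y⟫_ℝ := by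
  rw [← sum_inner_mul_inner_left e x y, Finset.mul_sum]
  exact Finset.sum_congr rfl fun i _ => by ring

/-- The diagonal contraction in the square of the horizontal curvature components. -/
theorem sum_inner_diag (e : OrthonormalBasis ι ℝ W) (M N : W →ₗ[ℝ] W) (x y : W) :
    ∑ i, ∑ j, ∑ k, (⟪x, e k⟫_ℝ * ⟪M (e i), e j⟫_ℝ) * (⟪y, e k⟫_ℝ * ⟪N (e i), e j⟫_ℝ)
      = ⟪x, y⟫_ℝ * ∑ i, ⟪M (e i), N (e i)⟫_ℝ := by
  have hk : ∀ i j,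
      ∑ k, (⟪x, e k⟫_ℝ * ⟪M (e i), e j⟫_ℝ) * (⟪y, e k⟫_ℝ * ⟪N (e i), e j⟫_ℝ)
        = ⟪x, y⟫_ℝ * (⟪M (e i), e j⟫_ℝ * ⟪N (e i), e j⟫_ℝ) := by
    intro i j
    rw [← sum_inner_mul_inner_left e x y, Finset.sum_mul]
    exact Finset.sum_congr rfl fun k _ => by ring
  simp only [hk, ← Finset.mul_sum, sum_inner_mul_inner_left]

/-- The off-diagonal contraction in the square of the horizontal curvature components. -/
theorem sum_inner_cross (e : OrthonormalBasis ι ℝ W) {M N : W →ₗ[ℝ] W}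
    (hM : ∀ u v, ⟪M u, v⟫_ℝ = -⟪u, M v⟫_ℝ) (hN : ∀ u v, ⟪N u, v⟫_ℝ = -⟪u, N v⟫_ℝ) (x y : W) :
    ∑ i, ∑ j, ∑ k, (⟪x, e k⟫_ℝ * ⟪M (e i), e j⟫_ℝ) * (⟪N (e i), e k⟫_ℝ * ⟪y, e j⟫_ℝ)
      = ⟪N x, M y⟫_ℝ := by
  have h : ∀ i, ⟪N x, e i⟫_ℝ * ⟪M y, e i⟫_ℝ = ⟪x, N (e i)⟫_ℝ * ⟪M (e i), y⟫_ℝ := by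
    intro i
    rw [hN, hM y, real_inner_comm y]
    ring
  have hk : ∀ i j,
      ∑ k, (⟪x, e k⟫_ℝ * ⟪M (e i), e j⟫_ℝ) * (⟪N (e i), e k⟫_ℝ * ⟪y, e j⟫_ℝ)
        = ⟪x, N (e i)⟫_ℝ * (⟪M (e i), e j⟫_ℝ * ⟪y, e j⟫_ℝ) := by
    intro i j
    rw [← sum_inner_mul_inner_left e x, Finset.sum_mul]
    exact Finset.sum_congr rfl fun k _ => by ring
  simp only [hk, ← Finset.mul_sum, sum_inner_mul_inner_left, ← h]

theorem sum_horizontal_mul_horizontal (e : OrthonormalBasis ι ℝ W) {M N : W →ₗ[ℝ] W}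
    (hM : ∀ u v, ⟪M u, v⟫_ℝ = -⟪u, M v⟫_ℝ) (hN : ∀ u v, ⟪N u, v⟫_ℝ = -⟪u, N v⟫_ℝ) (x y : W) :
    ∑ i, ∑ j, ∑ k,
      (-(⟪x, e k⟫_ℝ * ⟪M (e i), e j⟫_ℝ) + ⟪M (e i), e k⟫_ℝ * ⟪x, e j⟫_ℝ
        + 2 * (⟪M (e j), e k⟫_ℝ * ⟪x, e i⟫_ℝ)) *
      (-(⟪y, e k⟫_ℝ * ⟪N (e i), e j⟫_ℝ) + ⟪N (e i), e k⟫_ℝ * ⟪y, e j⟫_ℝ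
        + 2 * (⟪N (e j), e k⟫_ℝ * ⟪y, e i⟫_ℝ))
      = 6 * (⟪x, y⟫_ℝ * ∑ i, ⟪M (e i), N (e i)⟫_ℝ) + 6 * ⟪N x, M y⟫_ℝ := by
  set D : ι → ι → ι → ℝ := fun i j k =>
    (⟪x, e k⟫_ℝ * ⟪M (e i), e j⟫_ℝ) * (⟪y, e k⟫_ℝ * ⟪N (e i), e j⟫_ℝ) with hD
  set C : ι → ι → ι → ℝ := fun i j k =>
    (⟪x, e k⟫_ℝ * ⟪M (e i), e j⟫_ℝ) * (⟪N (e i), e k⟫_ℝ * ⟪y, e j⟫_ℝ) with hC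
  have sM : ∀ i j, ⟪M (e i), e j⟫_ℝ = -⟪M (e j), e i⟫_ℝ := fun i j => by
    rw [hM, real_inner_comm]
  have sN : ∀ i j, ⟪N (e i), e j⟫_ℝ = -⟪N (e j), e i⟫_ℝ := fun i j => by
    rw [hN, real_inner_comm]
  have swap : ∀ f : ι → ι → ι → ℝ, ∑ i, ∑ j, ∑ k, f i k j = ∑ i, ∑ j, ∑ k, f i j k :=
    fun f => Finset.sum_congr rfl fun i _ => Finset.sum_comm
  have swap' : ∀ f : ι → ι → ι → ℝ, ∑ i, ∑ j, ∑ k, f j i k = ∑ i, ∑ j, ∑ k, f i j k :=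
    fun f => Finset.sum_comm
  have rot : ∀ f : ι → ι → ι → ℝ, ∑ i, ∑ j, ∑ k, f j k i = ∑ i, ∑ j, ∑ k, f i j k :=
    fun f => (swap' fun i j k => f i k j).trans (swap f)
  have rot' : ∀ f : ι → ι → ι → ℝ, ∑ i, ∑ j, ∑ k, f k i j = ∑ i, ∑ j, ∑ k, f i j k :=
    fun f => (swap fun i j k => f j i k).trans (swap' f)
  have hterm : ∀ i j k,
      (-(⟪x, e k⟫_ℝ * ⟪M (e i), e j⟫_ℝ) + ⟪M (e i), e k⟫_ℝ * ⟪x, e j⟫_ℝ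
        + 2 * (⟪M (e j), e k⟫_ℝ * ⟪x, e i⟫_ℝ)) *
      (-(⟪y, e k⟫_ℝ * ⟪N (e i), e j⟫_ℝ) + ⟪N (e i), e k⟫_ℝ * ⟪y, e j⟫_ℝ
        + 2 * (⟪N (e j), e k⟫_ℝ * ⟪y, e i⟫_ℝ))
      = D i j k + D i k j + 4 * D j k i - C i j k - C i k j + 2 * C j i k + 2 * C j k i
        + 2 * C k i j + 2 * C k j i := by
    intro i j k
    simp only [hD, hC]
    rw [sM j i, sN j i, sM k j, sN k j, sM k i, sN k i]
    ring
  simp only [hterm, Finset.sum_add_distrib, Finset.sum_sub_distrib, ← Finset.mul_sum]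
  rw [swap D, rot D, swap C, swap' C, rot C, rot' C,
    show ∑ i, ∑ j, ∑ k, C k j i = ∑ i, ∑ j, ∑ k, C i j k from
      (swap' fun i j k => C k i j).trans (rot' C)]
  rw [show ∑ i, ∑ j, ∑ k, D i j k = _ from sum_inner_diag e M N x y,
    show ∑ i, ∑ j, ∑ k, C i j k = _ from sum_inner_cross e hM hN x y]
  ring

end SkewFamily

section TwoStep

variable {br nab : V → V → V} {𝔷 : Submodule ℝ V}

theorem IsLieBracket.smul_right_s18 (hbr : IsLieBracket br) (c : ℝ) (X Y : V) :
    br X (c • Y) = c • br X Y := by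
  rw [hbr.antisymm, hbr.smul_left, hbr.antisymm Y X, smul_neg, neg_neg]

theorem IsLieBracket.add_right (hbr : IsLieBracket br) (X Y Z : V) :
    br X (Y + Z) = br X Y + br X Z := by
  rw [hbr.antisymm, hbr.add_left, hbr.antisymm Y X, hbr.antisymm Z X]
  abel

theorem IsLieBracket.zero_left (hbr : IsLieBracket br) (X : V) : br 0 X = 0 := by
  simpa using hbr.smul_left 0 0 X

theorem IsLieBracket.zero_right (hbr : IsLieBracket br) (X : V) : br X 0 = 0 := by
  simpa using hbr.smul_right_s18 0 X 0

/-- Elements of the derived algebra of a 2-step nilpotent Lie algebra are central. -/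
theorem IsLieBracket.left_eq_zero_of_mem (hbr : IsLieBracket br)
    (h2step : ∀ X Y Z : V, br (br X Y) Z = 0)
    (h𝔷 : 𝔷 = Submodule.span ℝ {z : V | ∃ X Y : V, br X Y = z}) {A : V} (hA : A ∈ 𝔷) (X : V) :
    br A X = 0 := by
  rw [h𝔷] at hA
  induction hA using Submodule.span_induction with
  | mem z hz => obtain ⟨U, W, rfl⟩ := hz; exact h2step U W X
  | zero => exact hbr.zero_left X
  | add a b _ _ ha hb => rw [hbr.add_left, ha, hb, add_zero]
  | smul c a _ ha => rw [hbr.smul_left, ha, smul_zero]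

/-- A bracket whose values lie in a central subspace `𝔷`, together with the maps `J` on `𝔷ᗮ`
that represent it. -/
structure IsCentralBracket (br : V → V → V) (𝔷 : Submodule ℝ V) (J : 𝔷 → (𝔷ᗮ →ₗ[ℝ] 𝔷ᗮ)) :
    Prop extends IsLieBracket br where
  mem : ∀ X Y, br X Y ∈ 𝔷
  left_zero : ∀ (A : 𝔷) (X : V), br A X = 0
  inner_J : ∀ (A : 𝔷) (X Y : 𝔷ᗮ), ⟪J A X, Y⟫_ℝ = ⟪br (X : V) (Y : V), (A : V)⟫_ℝ

namespace IsCentralBracket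

variable {J : 𝔷 → (𝔷ᗮ →ₗ[ℝ] 𝔷ᗮ)}

theorem right_zero (h : IsCentralBracket br 𝔷 J) (A : 𝔷) (X : V) : br X A = 0 := by
  rw [h.antisymm, h.left_zero, neg_zero]

theorem inner_coe_eq_zero (A : 𝔷) (X : 𝔷ᗮ) : ⟪(A : V), (X : V)⟫_ℝ = 0 :=
  Submodule.inner_right_of_mem_orthogonal A.2 X.2

theorem inner_coe_eq_zero' (A : 𝔷) (X : 𝔷ᗮ) : ⟪(X : V), (A : V)⟫_ℝ = 0 :=
  Submodule.inner_left_of_mem_orthogonal A.2 X.2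

theorem inner_br_coe (h : IsCentralBracket br 𝔷 J) (U W : V) (X : 𝔷ᗮ) :
    ⟪br U W, (X : V)⟫_ℝ = 0 :=
  inner_coe_eq_zero ⟨br U W, h.mem U W⟩ X

theorem skew (h : IsCentralBracket br 𝔷 J) (A : 𝔷) (X Y : 𝔷ᗮ) :
    ⟪J A X, Y⟫_ℝ = -⟪X, J A Y⟫_ℝ := by
  rw [real_inner_comm (J A Y) X, h.inner_J, h.inner_J, h.antisymm, inner_neg_left]

theorem inner_comp (h : IsCentralBracket br 𝔷 J) (A B : 𝔷) (X Y : 𝔷ᗮ) :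
    ⟪J A (J B X), Y⟫_ℝ = ⟪X, J B (J A Y)⟫_ℝ := by
  rw [h.skew, h.skew, neg_neg]

theorem inner_br_left (h : IsCentralBracket br 𝔷 J) [𝔷.HasOrthogonalProjection]
    (A : 𝔷) (X : 𝔷ᗮ) (W : V) : ⟪br X W, (A : V)⟫_ℝ = ⟪((J A X : 𝔷ᗮ) : V), W⟫_ℝ := by
  obtain ⟨B, hB, Y, hY, rfl⟩ := 𝔷.exists_add_mem_mem_orthogonal W
  lift B to 𝔷 using hB
  lift Y to 𝔷ᗮ using hY
  rw [h.add_right, h.right_zero, zero_add, inner_add_right, inner_coe_eq_zero', zero_add,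
    ← h.inner_J, Submodule.coe_inner]

theorem inner_br_right (h : IsCentralBracket br 𝔷 J) [𝔷.HasOrthogonalProjection]
    (A : 𝔷) (X : 𝔷ᗮ) (W : V) : ⟪br W X, (A : V)⟫_ℝ = -⟪((J A X : 𝔷ᗮ) : V), W⟫_ℝ := by
  rw [h.antisymm, inner_neg_left, h.inner_br_left]

theorem nab_horizontal_horizontal (h : IsCentralBracket br 𝔷 J) (hnab : IsLeviCivita br nab)
    (X Y : 𝔷ᗮ) : nab X Y = (1 / 2 : ℝ) • br X Y := by
  refine ext_inner_right ℝ fun W => ?_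
  rw [hnab, h.inner_br_coe, h.inner_br_coe, real_inner_smul_left]
  ring

theorem nab_vertical_vertical (h : IsCentralBracket br 𝔷 J) (hnab : IsLeviCivita br nab)
    (A B : 𝔷) : nab A B = 0 := by
  refine ext_inner_right ℝ fun W => ?_
  simp [hnab (A : V), h.left_zero, h.right_zero]

theorem inner_br_br (h : IsCentralBracket br 𝔷 J) {κ : Type*} [Fintype κ]
    (e : OrthonormalBasis κ ℝ 𝔷) (X Y Z W : 𝔷ᗮ) :
    ⟪br X Y, br Z W⟫_ℝ = ∑ a, ⟪J (e a) X, Y⟫_ℝ * ⟪J (e a) Z, W⟫_ℝ := by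
  simp only [h.inner_J]
  exact (sum_inner_mul_inner_left e ⟨br X Y, h.mem _ _⟩ ⟨br Z W, h.mem _ _⟩).symm

variable [𝔷.HasOrthogonalProjection]

theorem nab_horizontal_vertical (h : IsCentralBracket br 𝔷 J) (hnab : IsLeviCivita br nab)
    (X : 𝔷ᗮ) (A : 𝔷) : nab X A = (-(1 / 2) : ℝ) • ((J A X : 𝔷ᗮ) : V) := by
  refine ext_inner_right ℝ fun W => ?_
  rw [hnab, h.right_zero, h.left_zero, h.inner_br_right, real_inner_smul_left, inner_zero_left,
    inner_zero_left]
  ring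

theorem nab_vertical_horizontal (h : IsCentralBracket br 𝔷 J) (hnab : IsLeviCivita br nab)
    (A : 𝔷) (X : 𝔷ᗮ) : nab A X = (-(1 / 2) : ℝ) • ((J A X : 𝔷ᗮ) : V) := by
  refine ext_inner_right ℝ fun W => ?_
  rw [hnab, h.left_zero, h.right_zero, h.inner_br_left, real_inner_smul_left, inner_zero_left,
    inner_zero_left]
  ring

/-- All components of the curvature tensor with respect to the splitting `𝔷 ⊕ 𝔷ᗮ`, expressed
through the maps `J`. -/
structure CurvatureComponents (br nab : V → V → V) (J : 𝔷 → (𝔷ᗮ →ₗ[ℝ] 𝔷ᗮ)) : Prop where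
  hhhh : ∀ X Y Z W : 𝔷ᗮ, curv br nab X Y Z W = (1 / 4) *
    (-⟪br X W, br Y Z⟫_ℝ + ⟪br Y W, br X Z⟫_ℝ + 2 * ⟪br Z W, br X Y⟫_ℝ)
  hhhv : ∀ (X Y Z : 𝔷ᗮ) (A : 𝔷), curv br nab X Y Z A = 0
  hhvh : ∀ (X Y Z : 𝔷ᗮ) (A : 𝔷), curv br nab X Y A Z = 0
  hvhh : ∀ (X Y Z : 𝔷ᗮ) (A : 𝔷), curv br nab X A Y Z = 0
  vhhh : ∀ (X Y Z : 𝔷ᗮ) (A : 𝔷), curv br nab A X Y Z = 0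
  hhvv : ∀ (X Y : 𝔷ᗮ) (A B : 𝔷),
    curv br nab X Y A B = (1 / 4) * ⟪J A (J B X) - J B (J A X), Y⟫_ℝ
  hvhv : ∀ (X Y : 𝔷ᗮ) (A B : 𝔷), curv br nab X A Y B = (1 / 4) * ⟪J A (J B X), Y⟫_ℝ
  hvvh : ∀ (X Y : 𝔷ᗮ) (A B : 𝔷), curv br nab X A B Y = -(1 / 4) * ⟪J A (J B X), Y⟫_ℝ
  vhhv : ∀ (X Y : 𝔷ᗮ) (A B : 𝔷), curv br nab A X Y B = -(1 / 4) * ⟪J A (J B X), Y⟫_ℝ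
  vhvh : ∀ (X Y : 𝔷ᗮ) (A B : 𝔷), curv br nab A X B Y = (1 / 4) * ⟪J A (J B X), Y⟫_ℝ
  vvhh : ∀ (X Y : 𝔷ᗮ) (A B : 𝔷),
    curv br nab A B X Y = (1 / 4) * ⟪J A (J B X) - J B (J A X), Y⟫_ℝ
  hvvv : ∀ (X : 𝔷ᗮ) (A B C : 𝔷), curv br nab X A B C = 0
  vhvv : ∀ (X : 𝔷ᗮ) (A B C : 𝔷), curv br nab A X B C = 0
  vvhv : ∀ (X : 𝔷ᗮ) (A B C : 𝔷), curv br nab A B X C = 0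
  vvvh : ∀ (X : 𝔷ᗮ) (A B C : 𝔷), curv br nab A B C X = 0
  vvvv : ∀ A B C D : 𝔷, curv br nab A B C D = 0

theorem nab_smul_right (hbr : IsLieBracket br) (hnab : IsLeviCivita br nab) (c : ℝ) (X Y : V) :
    nab X (c • Y) = c • nab X Y := by
  refine ext_inner_right ℝ fun W => ?_
  rw [real_inner_smul_left, hnab, hnab, hbr.smul_left, hbr.smul_right_s18, real_inner_smul_left,
    real_inner_smul_left, real_inner_smul_right]
  ring

theorem nab_zero_right (hbr : IsLieBracket br) (hnab : IsLeviCivita br nab) (X : V) :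
    nab X 0 = 0 := by
  simpa using nab_smul_right hbr hnab 0 X 0

theorem nab_zero_left (hbr : IsLieBracket br) (hnab : IsLeviCivita br nab) (X : V) :
    nab 0 X = 0 := by
  refine ext_inner_right ℝ fun W => ?_
  simp [hnab 0 X, hbr.zero_left, hbr.zero_right]

theorem curvatureComponents (h : IsCentralBracket br 𝔷 J) (hnab : IsLeviCivita br nab) :
    CurvatureComponents br nab J := by
  have hb := h.toIsLieBracket
  have inner_nab_br_right : ∀ (U X Y W : V), ⟪nab U (br X Y), W⟫_ℝ =
      (1 / 2) * ⟪br W U, br X Y⟫_ℝ := fun U X Y W => by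
    rw [hnab, h.right_zero ⟨br X Y, h.mem X Y⟩, h.left_zero ⟨br X Y, h.mem X Y⟩]
    simp
  have inner_nab_br_left : ∀ (U X Y W : V), ⟪nab (br X Y) U, W⟫_ℝ =
      -(1 / 2) * ⟪br U W, br X Y⟫_ℝ := fun U X Y W => by
    rw [hnab, h.right_zero ⟨br X Y, h.mem X Y⟩, h.left_zero ⟨br X Y, h.mem X Y⟩]
    simp
  have skew' : ∀ (A B : 𝔷) (X Y : 𝔷ᗮ), ⟪J A (J B X), Y⟫_ℝ = -⟪J B X, J A Y⟫_ℝ :=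
    fun A B X Y => h.skew A _ _
  have key : ∀ (A : 𝔷) (X Y : 𝔷ᗮ), ⟪br (X : V) (Y : V), (A : V)⟫_ℝ = ⟪J A X, Y⟫_ℝ :=
    fun A X Y => (h.inner_J A X Y).symm
  constructor <;> intros <;>
    simp only [curv, curvOp, h.nab_horizontal_horizontal hnab, h.nab_horizontal_vertical hnab,
      h.nab_vertical_horizontal hnab, h.nab_vertical_vertical hnab, nab_smul_right hb hnab,
      nab_zero_right hb hnab, nab_zero_left hb hnab, h.left_zero, h.right_zero, inner_sub_left,
      real_inner_smul_left, inner_zero_left, inner_nab_br_right,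
      inner_nab_br_left, h.inner_br_coe, inner_coe_eq_zero', key, skew',
      ← Submodule.coe_inner, mul_zero, sub_zero]
  case hhhh X Y Z W =>
    rw [h.antisymm W X, h.antisymm W Y, inner_neg_left, inner_neg_left]
    ring
  case hhvv X Y A B =>
    rw [real_inner_comm (J A X)]
    ring
  all_goals ring

theorem checkR_horizontal_vertical (h : IsCentralBracket br 𝔷 J) (hnab : IsLeviCivita br nab)
    {ιz ιv : Type*} [Fintype ιz] [Fintype ιv]
    (ez : OrthonormalBasis ιz ℝ 𝔷) (ev : OrthonormalBasis ιv ℝ 𝔷ᗮ)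
    (E : OrthonormalBasis (ιz ⊕ ιv) ℝ V)
    (hEz : ∀ a : ιz, E (Sum.inl a) = (ez a : V)) (hEv : ∀ i : ιv, E (Sum.inr i) = (ev i : V))
    (X : 𝔷ᗮ) (A : 𝔷) : checkR br nab E (X : V) (A : V) = 0 := by
  have c := h.curvatureComponents hnab
  simp [checkR, Fintype.sum_sum_type, hEz, hEv, c.hhhv, c.hhvh, c.hvhh, c.vhhh, c.hvvv, c.vhvv,
    c.vvhv, c.vvvh, c.vvvv]

theorem checkR_vertical_vertical (h : IsCentralBracket br 𝔷 J) (hnab : IsLeviCivita br nab)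
    {ιz ιv : Type*} [Fintype ιz] [Fintype ιv]
    (ez : OrthonormalBasis ιz ℝ 𝔷) (ev : OrthonormalBasis ιv ℝ 𝔷ᗮ)
    (E : OrthonormalBasis (ιz ⊕ ιv) ℝ V)
    (hEz : ∀ a : ιz, E (Sum.inl a) = (ez a : V)) (hEv : ∀ i : ιv, E (Sum.inr i) = (ev i : V))
    (A B : 𝔷) : checkR br nab E (A : V) (B : V) = (1 / 16) * ∑ c, ∑ i,
      (⟪J A (J (ez c) (ev i)) - J (ez c) (J A (ev i)),
          J B (J (ez c) (ev i)) - J (ez c) (J B (ev i))⟫_ℝ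
        + 2 * ⟪J A (J (ez c) (ev i)), J B (J (ez c) (ev i))⟫_ℝ) := by
  have c := h.curvatureComponents hnab
  simp only [checkR, Fintype.sum_sum_type, hEz, hEv, c.vhhh, c.vhhv, c.vhvh, c.vvhh, c.vhvv,
    c.vvhv, c.vvvh, c.vvvv, mul_zero, Finset.sum_const_zero, add_zero, zero_add]
  have swap : ∀ F : ιv → ιz → ℝ, ∑ i, ∑ a, F i a = ∑ a, ∑ i, F i a :=
    fun F => Finset.sum_comm
  simp only [Finset.sum_add_distrib, swap, sum_mul_inner_mul_mul_inner, ← Finset.mul_sum]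
  ring

theorem checkR_horizontal_horizontal (h : IsCentralBracket br 𝔷 J) (hnab : IsLeviCivita br nab)
    {ιz ιv : Type*} [Fintype ιz] [Fintype ιv]
    (ez : OrthonormalBasis ιz ℝ 𝔷) (ev : OrthonormalBasis ιv ℝ 𝔷ᗮ)
    (E : OrthonormalBasis (ιz ⊕ ιv) ℝ V)
    (hEz : ∀ a : ιz, E (Sum.inl a) = (ez a : V)) (hEv : ∀ i : ιv, E (Sum.inr i) = (ev i : V))
    (X Y : 𝔷ᗮ) : checkR br nab E (X : V) (Y : V) = (1 / 16) * ∑ a, ∑ b,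
      (6 * (⟪J (ez a) X, J (ez b) Y⟫_ℝ * ∑ i, ⟪J (ez a) (ev i), J (ez b) (ev i)⟫_ℝ)
        + 6 * ⟪J (ez b) (J (ez a) X), J (ez a) (J (ez b) Y)⟫_ℝ
        + ⟪J (ez a) (J (ez b) X) - J (ez b) (J (ez a) X),
          J (ez a) (J (ez b) Y) - J (ez b) (J (ez a) Y)⟫_ℝ
        + 2 * ⟪J (ez a) (J (ez b) X), J (ez a) (J (ez b) Y)⟫_ℝ) := by
  have c := h.curvatureComponents hnab
  have hhhh : ∀ (X : 𝔷ᗮ) i j k, curv br nab X (ev i) (ev j) (ev k) = (1 / 4) * ∑ a,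
      (-(⟪J (ez a) X, ev k⟫_ℝ * ⟪J (ez a) (ev i), ev j⟫_ℝ)
        + ⟪J (ez a) (ev i), ev k⟫_ℝ * ⟪J (ez a) X, ev j⟫_ℝ
        + 2 * (⟪J (ez a) (ev j), ev k⟫_ℝ * ⟪J (ez a) X, ev i⟫_ℝ)) := by
    intro X i j k
    rw [c.hhhh]
    simp only [h.inner_br_br ez, ← Finset.mul_sum, Finset.sum_add_distrib, Finset.sum_neg_distrib]
  have skew : ∀ a (u v : 𝔷ᗮ), ⟪J (ez a) u, v⟫_ℝ = -⟪u, J (ez a) v⟫_ℝ := fun a => h.skew (ez a)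
  have hsq : ∑ i, ∑ j, ∑ k,
      curv br nab X (ev i) (ev j) (ev k) * curv br nab Y (ev i) (ev j) (ev k)
      = (1 / 4 * (1 / 4)) * ∑ a, ∑ b,
        (6 * (⟪J (ez a) X, J (ez b) Y⟫_ℝ * ∑ i, ⟪J (ez a) (ev i), J (ez b) (ev i)⟫_ℝ)
          + 6 * ⟪J (ez b) (J (ez a) X), J (ez a) (J (ez b) Y)⟫_ℝ) := by
    simp only [hhhh, mul_mul_mul_comm (1 / 4 : ℝ) _ (1 / 4 : ℝ), ← Finset.mul_sum]
    rw [sum_triple_sum_mul_sum]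
    simp only [sum_horizontal_mul_horizontal ev (skew _) (skew _)]
  have swap : ∀ F : ιv → ιz → ℝ, ∑ i, ∑ a, F i a = ∑ a, ∑ i, F i a :=
    fun F => Finset.sum_comm
  simp only [checkR, Fintype.sum_sum_type, hEz, hEv, c.hhhv, c.hhvh, c.hvhh, c.hvvv,
    c.hhvv, c.hvhv, c.hvvh, mul_zero, Finset.sum_const_zero, add_zero, zero_add,
    Finset.sum_add_distrib, hsq]
  simp only [swap, sum_mul_inner_mul_mul_inner, ← Finset.mul_sum]
  ring

end IsCentralBracket

end TwoStep

/-- For a 2-step nilpotent metric Lie algebra with derived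
algebra `𝔷` and orthogonal complement `𝔳 = 𝔷ᗮ`, with skew-symmetric maps
`J_A` on `𝔳` defined by `⟨J_A X, Y⟩ = ⟨[X,Y], A⟩`, orthonormal bases `(e_a)`
of `𝔷` and `(e_i)` of `𝔳` (combined into an orthonormal basis `E` of the whole
algebra), and `S_{ab} = −(1/2)(J_a J_b + J_b J_a)`, the tensor `Ř` satisfies
`Ř(X,A) = 0`, `Ř(e_a,e_b) = (1/8) Σ_c Tr(3 S_{ab}S_{cc} − 2 S_{ac}S_{bc})`, and
`Ř(X,Y) = (1/8) Σ_{a,b} ⟨(4 S_{ab}² + 3 Tr(S_{ab}) S_{ab})X, Y⟩`. -/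
theorem twoStep_checkR_formulas
    {V : Type*} [NormedAddCommGroup V] [InnerProductSpace ℝ V] [FiniteDimensional ℝ V]
    (br : V → V → V) (hbr : IsLieBracket br)
    (h2step : ∀ X Y Z : V, br (br X Y) Z = 0)
    (nab : V → V → V) (hnab : IsLeviCivita br nab)
    (𝔷 : Submodule ℝ V)
    (h𝔷 : 𝔷 = Submodule.span ℝ {z : V | ∃ X Y : V, br X Y = z})
    (J : 𝔷 → (𝔷ᗮ →ₗ[ℝ] 𝔷ᗮ))
    (hJ : ∀ (A : 𝔷) (X Y : 𝔷ᗮ), ⟪J A X, Y⟫_ℝ = ⟪br (X : V) (Y : V), (A : V)⟫_ℝ)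
    {ιz ιv : Type*} [Fintype ιz] [Fintype ιv]
    (ez : OrthonormalBasis ιz ℝ 𝔷) (ev : OrthonormalBasis ιv ℝ 𝔷ᗮ)
    (E : OrthonormalBasis (ιz ⊕ ιv) ℝ V)
    (hEz : ∀ a : ιz, E (Sum.inl a) = (ez a : V))
    (hEv : ∀ i : ιv, E (Sum.inr i) = (ev i : V))
    (S : ιz → ιz → (𝔷ᗮ →ₗ[ℝ] 𝔷ᗮ))
    (hSab : ∀ a b : ιz,
      S a b = (-(1 / 2) : ℝ) • (J (ez a) ∘ₗ J (ez b) + J (ez b) ∘ₗ J (ez a))) :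
    (∀ (X : 𝔷ᗮ) (A : 𝔷), checkR br nab E (X : V) (A : V) = 0) ∧
      (∀ a b : ιz, checkR br nab E (ez a : V) (ez b : V)
          = (1 / 8) * ∑ c : ιz, LinearMap.trace ℝ 𝔷ᗮ
              ((3 : ℝ) • (S a b ∘ₗ S c c) - (2 : ℝ) • (S a c ∘ₗ S b c))) ∧
      (∀ X Y : 𝔷ᗮ, checkR br nab E (X : V) (Y : V)
          = (1 / 8) * ∑ a : ιz, ∑ b : ιz,
              ⟪((4 : ℝ) • (S a b ∘ₗ S a b)
                + ((3 : ℝ) * LinearMap.trace ℝ 𝔷ᗮ (S a b)) • S a b) X, Y⟫_ℝ) := by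
  have h : IsCentralBracket br 𝔷 J :=
    { hbr with
      mem := fun X Y => h𝔷 ▸ Submodule.subset_span ⟨X, Y, rfl⟩
      left_zero := fun A X => hbr.left_eq_zero_of_mem h2step h𝔷 A.2 X
      inner_J := hJ }
  refine ⟨fun X A => h.checkR_horizontal_vertical hnab ez ev E hEz hEv X A, fun a b => ?_,
    fun X Y => ?_⟩
  · rw [h.checkR_vertical_vertical hnab ez ev E hEz hEv]
    have trace_eq : ∀ A B C D : 𝔷, ∑ i, ⟪J A (J B (ev i)), J C (J D (ev i))⟫_ℝ
        = LinearMap.trace ℝ 𝔷ᗮ (J D * J C * J A * J B) := fun A B C D => by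
      rw [LinearMap.trace_eq_sum_inner _ ev]
      refine Finset.sum_congr rfl fun i _ => ?_
      rw [real_inner_comm, h.inner_comp]
      rfl
    have cyc : ∀ A B C D : 𝔷, LinearMap.trace ℝ 𝔷ᗮ (J A * J B * J C * J D)
        = LinearMap.trace ℝ 𝔷ᗮ (J B * J C * J D * J A) := fun A B C D => by
      rw [mul_assoc, mul_assoc, LinearMap.trace_mul_comm, ← mul_assoc]
    have rev : ∀ A B C D : 𝔷, LinearMap.trace ℝ 𝔷ᗮ (J A * J B * J C * J D)
        = LinearMap.trace ℝ 𝔷ᗮ (J D * J C * J B * J A) := fun A B C D => by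
      rw [← trace_eq, ← trace_eq]
      exact Finset.sum_congr rfl fun i _ => real_inner_comm _ _
    simp only [inner_sub_left, inner_sub_right, Finset.mul_sum _ _ (1 / 8 : ℝ)]
    rw [Finset.mul_sum]
    refine Finset.sum_congr rfl fun c _ => ?_
    simp only [Finset.sum_add_distrib, Finset.sum_sub_distrib, ← Finset.mul_sum, trace_eq,
      hSab, ← Module.End.mul_eq_comp, mul_add, add_mul, smul_mul_assoc, mul_smul_comm, smul_add,
      map_sub, map_add, map_smul, ← mul_assoc, smul_eq_mul]
    linarith [cyc (ez c) (ez b) (ez a) (ez c), rev (ez b) (ez a) (ez c) (ez c),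
      cyc (ez c) (ez c) (ez a) (ez b), cyc (ez c) (ez a) (ez b) (ez c),
      cyc (ez c) (ez b) (ez c) (ez a), cyc (ez b) (ez c) (ez a) (ez c),
      cyc (ez c) (ez a) (ez c) (ez b), cyc (ez b) (ez c) (ez c) (ez a),
      cyc (ez a) (ez c) (ez c) (ez b), cyc (ez c) (ez c) (ez b) (ez a)]
  · rw [h.checkR_horizontal_horizontal hnab ez ev E hEz hEv]
    simp only [Finset.mul_sum _ _ (1 / 16 : ℝ), Finset.mul_sum _ _ (1 / 8 : ℝ)]
    have trace_eq : ∀ a b, LinearMap.trace ℝ 𝔷ᗮ (S a b)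
        = ∑ i, ⟪J (ez a) (ev i), J (ez b) (ev i)⟫_ℝ := fun a b => by
      rw [LinearMap.trace_eq_sum_inner _ ev]
      refine Finset.sum_congr rfl fun i _ => ?_
      simp only [hSab, LinearMap.smul_apply, LinearMap.add_apply, LinearMap.comp_apply,
        real_inner_smul_right, inner_add_right]
      rw [real_inner_comm, h.skew, real_inner_comm, real_inner_comm (J _ _), h.skew]
      ring
    have trace_symm : ∀ a b, ∑ i, ⟪J (ez a) (ev i), J (ez b) (ev i)⟫_ℝ
        = ∑ i, ⟪J (ez b) (ev i), J (ez a) (ev i)⟫_ℝ := fun a b => by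
      exact Finset.sum_congr rfl fun i _ => real_inner_comm _ _
    refine sum_sum_eq_of_add_swap_eq fun a b => ?_
    simp only [trace_eq]
    rw [trace_symm b a]
    generalize ∑ i, ⟪J (ez a) (ev i), J (ez b) (ev i)⟫_ℝ = T
    simp only [hSab, LinearMap.smul_apply, LinearMap.add_apply, LinearMap.comp_apply, map_add,
      map_smul, real_inner_smul_left, inner_add_left, inner_sub_left, inner_sub_right, h.skew]
    ring
end
end
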